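/- arXiv:1610.06979 — 4 statements merged into one kernel-verified Lean document; each statement's English description precedes it below -/
import Mathlib

section
/- Let G = G[X,Y] be a bipartite graph with bipartition (X,Y), |X| = |Y| = n ≥ 2t, minimum degree δ(G) ≥ t (where t ≥ 1), and m edges. If m ≥ n² − tn + t², then G is Hamiltonian unless G is isomorphic to H_{t,n−t}. -/
open SimpleGraph Finset

/-- The transmission of a vertex: sum of distances to all other vertices. -/
noncomputable def transmission {V : Type*} [Fintype V] (G : SimpleGraph V) (u : V) : ℕ :=
  ∑ v, G.dist u v

/-- The transmission σ(G): sum of distances over all unordered pairs. -/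
noncomputable def transmissionOf {V : Type*} [Fintype V] (G : SimpleGraph V) : ℝ :=
  (1 / 2) * ∑ u, ∑ v, (G.dist u v : ℝ)

/-- The distance signless Laplacian matrix Q_D(G) = Tr(G) + 𝒟(G). -/
noncomputable def distSignlessLaplacian {V : Type*} [Fintype V] [DecidableEq V]
    (G : SimpleGraph V) : Matrix V V ℝ :=
  fun u v => (if u = v then (transmission G u : ℝ) else 0) + (G.dist u v : ℝ)

/-- `ρ` is the distance signless Laplacian spectral radius of `G`,
i.e. the largest eigenvalue of `Q_D(G)`. -/
noncomputable def IsDistSLSpectralRadius {V : Type*} [Fintype V] [DecidableEq V]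
    (G : SimpleGraph V) (ρ : ℝ) : Prop :=
  IsGreatest {μ : ℝ | Module.End.HasEigenvalue (Matrix.toLin' (distSignlessLaplacian G)) μ} ρ

/-- Join of two graphs. -/
def joinGraph {α β : Type*} (G : SimpleGraph α) (H : SimpleGraph β) : SimpleGraph (α ⊕ β) :=
  SimpleGraph.fromRel (fun x y =>
    match x, y with
    | Sum.inl a, Sum.inl b => G.Adj a b
    | Sum.inr a, Sum.inr b => H.Adj a b
    | Sum.inl _, Sum.inr _ => True
    | Sum.inr _, Sum.inl _ => False)

/-- The graph H_{t,n-t}. -/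
def HGraph (n t : ℕ) : SimpleGraph (Fin n ⊕ Fin n) :=
  SimpleGraph.fromRel (fun x y =>
    match x, y with
    | Sum.inl i, Sum.inr j => (j : ℕ) < n - t ∨ (i : ℕ) < t
    | _, _ => False)

/-- Hamilton-connected. -/
def IsHamiltonianConnected {V : Type*} [DecidableEq V] (G : SimpleGraph V) : Prop :=
  ∀ u v : V, u ≠ v → ∃ p : G.Walk u v, p.IsHamiltonian

/-- Traceable from every vertex. -/
def TraceableFromEveryVertex {V : Type*} [DecidableEq V] (G : SimpleGraph V) : Prop :=
  ∀ u : V, ∃ v : V, ∃ p : G.Walk u v, p.IsHamiltonian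

/-- K_{n-1} + e : complete graph on n-1 vertices with a pendant edge. -/
def KPlusPendant (n : ℕ) : SimpleGraph (Fin (n - 1) ⊕ Fin 1) :=
  SimpleGraph.fromRel (fun x y =>
    match x, y with
    | Sum.inl a, Sum.inl b => a ≠ b
    | Sum.inl a, Sum.inr _ => (a : ℕ) = 0
    | _, _ => False)

namespace SimpleGraph

variable {V : Type*} {H : SimpleGraph V} {X Y : Finset V} {x y : V} {n t : ℕ}

/-- A Hamiltonian path whose ends are adjacent closes up to a Hamiltonian cycle. -/
theorem IsHamiltonian.of_isHamiltonian_walk [Fintype V] [DecidableEq V] {p : H.Walk x y}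
    (hp : p.IsHamiltonian) (h : H.Adj y x) (hcard : 3 ≤ Fintype.card V) : H.IsHamiltonian := by
  intro _
  refine ⟨y, .cons h p, ?_⟩
  have hlen := hp.length_eq
  rw [Walk.isHamiltonianCycle_iff_isCycle_and_length_eq,
    Walk.isCycle_iff_isPath_tail_and_le_length]
  refine ⟨⟨?_, ?_⟩, ?_⟩
  · simpa using hp.isPath
  · simp only [Walk.length_cons]; lia
  · simp only [Walk.length_cons]; lia

/-- A Hamiltonian cycle created by adding the edge `xy` leaves a Hamiltonian path
between `x` and `y`. -/
theorem exists_isHamiltonian_walk_of_sup_edge [Fintype V] [DecidableEq V]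
    (hH : ¬ H.IsHamiltonian) (hne : x ≠ y) (hadd : (H ⊔ edge x y).IsHamiltonian) :
    ∃ p : H.Walk x y, p.IsHamiltonian := by
  have : Nontrivial V := ⟨x, y, hne⟩
  obtain ⟨c, hc⟩ := hadd.exists_isHamiltonianCycle x
  have mem_of_ne : ∀ e ∈ (H ⊔ edge x y).edgeSet, e ≠ s(x, y) → e ∈ H.edgeSet := by
    intro e
    induction e with | h a b
    simp only [mem_edgeSet, sup_adj, edge_adj, ne_eq, Sym2.eq_iff]
    tauto
  have key : ∀ c : (H ⊔ edge x y).Walk x x, c.IsHamiltonianCycle → c.snd = y →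
      ∃ p : H.Walk x y, p.IsHamiltonian := by
    intro c hc hy
    cases c with
    | nil => exact absurd hc.isCycle Walk.not_isCycle_nil
    | cons h q =>
      simp only [Walk.snd_cons] at hy
      subst hy
      have hq := (Walk.cons_isCycle_iff _ _).1 hc.isCycle
      have hham : q.IsHamiltonian := by
        intro a
        simpa using hc.isHamiltonian_tail a
      refine ⟨(q.transfer H fun e he => mem_of_ne e (q.edges_subset_edgeSet he) ?_).reverse, ?_⟩
      · rintro rfl
        exact hq.2 he
      · intro a
        simpa using hham a
  by_cases hsnd : c.snd = y
  · exact key c hc hsnd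
  by_cases hpen : c.penultimate = y
  · refine key c.reverse ?_ (by simpa using hpen)
    rw [Walk.isHamiltonianCycle_iff_isCycle_and_length_eq] at hc ⊢
    exact ⟨hc.1.reverse, by simpa using hc.2⟩
  refine absurd (fun _ => ⟨x, c.transfer H fun e he => mem_of_ne e (c.edges_subset_edgeSet he) ?_,
    ?_⟩) hH
  · rintro rfl
    cases c with
    | nil => exact absurd hc.isCycle Walk.not_isCycle_nil
    | cons h q =>
      have hq := (Walk.cons_isCycle_iff _ _).1 hc.isCycle
      simp only [Walk.snd_cons] at hsnd
      rw [Walk.edges_cons, List.mem_cons] at he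
      rcases he with he | he
      · simp only [Sym2.eq_iff] at he
        grind
      · have := hq.1.eq_penultimate_of_mem_edges he
        apply hpen
        exact (Walk.penultimate_cons_of_not_nil _ _ fun hn => h.ne hn.eq.symm).trans this.symm
  · rw [Walk.isHamiltonianCycle_iff_isCycle_and_length_eq] at hc ⊢
    exact ⟨hc.1.transfer _, by simpa using hc.2⟩

/-- If `x` and `y` are the ends of a Hamiltonian path in a non-Hamiltonian bipartite graph, then
no neighbour of `x` is the successor of a neighbour of `y` on the path. -/
theorem not_adj_getVert_of_not_isHamiltonian [Fintype V] [DecidableEq V]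
    (hH : ¬ H.IsHamiltonian) (hcard : 3 ≤ Fintype.card V) {p : H.Walk x y}
    (hp : p.IsHamiltonian) {i : ℕ} (hi : i < p.length) (hx : H.Adj x (p.getVert (i + 1))) :
    ¬ H.Adj y (p.getVert i) := by
  intro hy
  have hq : ((p.drop (i + 1)).append (.cons hy (p.take i).reverse)).IsHamiltonian := by
    intro a
    have hs : p.support = p.support.take (i + 1) ++ p.support.drop (i + 1) :=
      (List.take_append_drop _ _).symm
    have := hp a
    rw [hs, List.count_append] at this
    rw [Walk.support_append, Walk.support_cons, List.tail_cons, Walk.support_reverse,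
      Walk.support_take, Walk.drop_support_eq_support_drop_min, List.count_append,
      List.count_reverse, min_eq_left (by lia)]
    lia
  exact hH (.of_isHamiltonian_walk hq hx hcard)

/-- The bipartite analogue of Ore's lemma. -/
theorem card_add_card_le_of_isHamiltonian_walk [Fintype V] [DecidableEq V] [DecidableRel H.Adj]
    (hH : ¬ H.IsHamiltonian) (hcard : 3 ≤ Fintype.card V) (hb : H.IsBipartiteWith X Y)
    {p : H.Walk x y} (hp : p.IsHamiltonian) :
    #{v ∈ Y | H.Adj x v} + #{v ∈ X | H.Adj y v} ≤ #X := by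
  have hpred : ∀ v, H.Adj x v → ∃ i, i < p.length ∧ p.getVert (i + 1) = v := by
    intro v hv
    obtain ⟨j, hj, hjl⟩ := Walk.mem_support_iff_exists_getVert.1 (hp.mem_support v)
    cases j with
    | zero => rw [Walk.getVert_zero] at hj; exact absurd hj hv.ne
    | succ i => exact ⟨i, hjl, hj⟩
  choose! f hf using hpred
  have hinj : Set.InjOn (fun v => p.getVert (f v)) (({v ∈ Y | H.Adj x v} : Finset V) : Set V) := by
    intro a ha b hb hab
    simp only [coe_filter, Set.mem_ofPred_eq] at ha hb
    have := hp.isPath.getVert_injOn (hf a ha.2).1.le (hf b hb.2).1.le hab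
    rw [← (hf a ha.2).2, ← (hf b hb.2).2, this]
  rw [← card_image_of_injOn hinj, ← card_union_of_disjoint]
  · refine card_le_card (union_subset ?_ (filter_subset _ _))
    intro w hw
    simp only [mem_image, mem_filter] at hw
    obtain ⟨v, ⟨hvY, hv⟩, rfl⟩ := hw
    have hadj := p.adj_getVert_succ (hf v hv).1
    rw [(hf v hv).2] at hadj
    rcases hb.mem_of_adj hadj with h | h
    · exact h.1
    · exact absurd hvY (Finset.disjoint_left.1 (disjoint_coe.1 hb.disjoint) h.2)
  · rw [Finset.disjoint_left]
    intro w hw hw'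
    simp only [mem_image, mem_filter] at hw hw'
    obtain ⟨v, ⟨hvY, hv⟩, rfl⟩ := hw
    exact not_adj_getVert_of_not_isHamiltonian hH hcard hp (hf v hv).1
      (by rwa [(hf v hv).2]) hw'.2

theorem exists_isPath_of_forall_adj [DecidableEq V] (hdisj : Disjoint X Y)
    (hadj : ∀ a ∈ X, ∀ b ∈ Y, H.Adj a b) (k : ℕ) :
    ∀ A ⊆ X, ∀ B ⊆ Y, #A = k + 1 → #B = k + 1 → ∃ x ∈ A, ∃ y ∈ B, ∃ p : H.Walk x y,
      p.IsPath ∧ p.length = 2 * k + 1 ∧ ∀ v ∈ p.support, v ∈ A ∪ B := by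
  induction k with
  | zero =>
    intro A hA B hB hAc hBc
    obtain ⟨a, rfl⟩ := card_eq_one.1 hAc
    obtain ⟨b, rfl⟩ := card_eq_one.1 hBc
    simp only [singleton_subset_iff] at hA hB
    have h := hadj a hA b hB
    exact ⟨a, by simp, b, by simp, h.toWalk, by simp [h.ne], by simp, by simp⟩
  | succ k ih =>
    intro A hA B hB hAc hBc
    obtain ⟨a, ha⟩ := card_pos.1 (by lia : 0 < #A)
    obtain ⟨b, hb⟩ := card_pos.1 (by lia : 0 < #B)
    obtain ⟨x, hx, y, hy, p, hp, hlen, hsupp⟩ := ih (A.erase a) ((erase_subset _ _).trans hA)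
      (B.erase b) ((erase_subset _ _).trans hB) (by rw [card_erase_of_mem ha]; lia)
      (by rw [card_erase_of_mem hb]; lia)
    have hab := hadj a (hA ha) b (hB hb)
    have hbx := (hadj x (hA (mem_of_mem_erase hx)) b (hB hb)).symm
    have haB : a ∉ B := fun h => Finset.disjoint_left.1 hdisj (hA ha) (hB h)
    have hbA : b ∉ A := fun h => Finset.disjoint_left.1 hdisj (hA h) (hB hb)
    refine ⟨a, ha, y, mem_of_mem_erase hy, .cons hab (.cons hbx p), ?_, ?_, ?_⟩
    · simp only [Walk.cons_isPath_iff, Walk.support_cons, List.mem_cons, not_or]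
      refine ⟨⟨hp, fun h => ?_⟩, hab.ne, fun h => ?_⟩
      · have := hsupp _ h
        simp [hbA] at this
      · have := hsupp _ h
        simp [haB] at this
    · simp only [Walk.length_cons]; lia
    · intro v hv
      simp only [Walk.support_cons, List.mem_cons] at hv
      rcases hv with rfl | rfl | hv
      · simp [ha]
      · simp [hb]
      · have := hsupp v hv
        simp only [mem_union, mem_erase] at this ⊢
        tauto

/-- A balanced complete bipartite graph with at least four vertices is Hamiltonian. -/
theorem IsHamiltonian.of_forall_adj [Fintype V] [DecidableEq V] (hX : #X = n) (hY : #Y = n)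
    (hn : 2 ≤ n) (hdisj : Disjoint X Y) (hcover : X ∪ Y = univ)
    (hadj : ∀ a ∈ X, ∀ b ∈ Y, H.Adj a b) : H.IsHamiltonian := by
  have hcard : Fintype.card V = 2 * n := by
    rw [← card_univ, ← hcover, card_union_of_disjoint hdisj]; lia
  obtain ⟨x, hx, y, hy, p, hp, hlen, -⟩ := exists_isPath_of_forall_adj hdisj hadj (n - 1)
    X subset_rfl Y subset_rfl (by lia) (by lia)
  refine .of_isHamiltonian_walk (p := p) ?_ (hadj x hx y hy).symm (by lia)
  rw [Walk.isHamiltonian_iff_isPath_and_length_eq]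
  exact ⟨hp, by lia⟩

theorem card_filter_product_eq_sum {α β : Type*} (A : Finset α) (B : Finset β) (r : α → β → Prop)
    [∀ a b, Decidable (r a b)] :
    #{e ∈ A ×ˢ B | r e.1 e.2} = ∑ a ∈ A, #{b ∈ B | r a b} := by
  simp only [card_filter, sum_product]

theorem card_filter_product_swap {α β : Type*} (A : Finset α) (B : Finset β) (r : α → β → Prop)
    [∀ a b, Decidable (r a b)] :
    #{e ∈ B ×ˢ A | r e.2 e.1} = #{e ∈ A ×ˢ B | r e.1 e.2} := by
  simp only [card_filter, sum_product]
  exact sum_comm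

theorem card_filter_not_adj_swap [DecidableRel H.Adj] :
    #{e ∈ Y ×ˢ X | ¬ H.Adj e.1 e.2} = #{e ∈ X ×ˢ Y | ¬ H.Adj e.1 e.2} := by
  rw [← card_filter_product_swap X Y fun a b => ¬ H.Adj a b]
  exact congrArg card (filter_congr fun e _ => by rw [H.adj_comm])

/-- If all `r`-pairs are counted by those with first component in `A`, then they all have it. -/
theorem mem_of_forall_le_card_filter {α β : Type*} {X A : Finset α} {Y : Finset β}
    {r : α → β → Prop} [∀ a b, Decidable (r a b)] {c : ℕ} (hA : A ⊆ X)
    (hc : ∀ a ∈ A, c ≤ #{b ∈ Y | r a b}) (hle : #{e ∈ X ×ˢ Y | r e.1 e.2} ≤ #A * c)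
    {a : α} {b : β} (ha : a ∈ X) (hb : b ∈ Y) (hab : r a b) : a ∈ A := by
  have hsub : {e ∈ A ×ˢ Y | r e.1 e.2} ⊆ {e ∈ X ×ˢ Y | r e.1 e.2} :=
    filter_subset_filter _ (product_subset_product_left hA)
  have hcard : #A * c ≤ #{e ∈ A ×ˢ Y | r e.1 e.2} := by
    rw [card_filter_product_eq_sum, ← smul_eq_mul]
    exact card_nsmul_le_sum _ _ _ hc
  have heq := eq_of_subset_of_card_le hsub (hle.trans hcard)
  have hmem : (a, b) ∈ ({e ∈ X ×ˢ Y | r e.1 e.2} : Finset (α × β)) := by simp [ha, hb, hab]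
  rw [← heq] at hmem
  simp only [mem_filter, mem_product] at hmem
  exact hmem.1.1

/-- A bipartite graph with few missing edges, and a non-adjacent pair of maximal degree sum
at most `n`, misses exactly the edges between a `t`-set and an `(n - t)`-set. -/
theorem exists_forall_adj_iff_of_card_le [DecidableRel H.Adj] (hX : #X = n)
    (hY : #Y = n) (hx : x ∈ X) (hy : y ∈ Y) (hxy : ¬ H.Adj x y)
    (hsum : #{v ∈ Y | H.Adj x v} + #{v ∈ X | H.Adj y v} ≤ n)
    (hmax : ∀ a ∈ X, ∀ b ∈ Y, ¬ H.Adj a b → #{v ∈ Y | H.Adj a v} + #{v ∈ X | H.Adj b v} ≤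
      #{v ∈ Y | H.Adj x v} + #{v ∈ X | H.Adj y v})
    (hle : #{v ∈ Y | H.Adj x v} ≤ #{v ∈ X | H.Adj y v}) (ht : t ≤ #{v ∈ Y | H.Adj x v})
    (hmiss : #{e ∈ X ×ˢ Y | ¬ H.Adj e.1 e.2} ≤ t * (n - t)) :
    ∃ A ⊆ X, ∃ B ⊆ Y, #A = t ∧ #B = n - t ∧
      ∀ a ∈ X, ∀ b ∈ Y, (H.Adj a b ↔ ¬ (a ∈ A ∧ b ∈ B)) := by
  have hYc : ∀ a, #{v ∈ Y | H.Adj a v} + #{v ∈ Y | ¬ H.Adj a v} = n := fun a => by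
    rw [card_filter_add_card_filter_not, hY]
  have hXc : ∀ b, #{v ∈ X | H.Adj b v} + #{v ∈ X | ¬ H.Adj b v} = n := fun b => by
    rw [card_filter_add_card_filter_not, hX]
  set k := #{v ∈ Y | H.Adj x v} with hk
  set l := #{v ∈ X | H.Adj y v} with hl
  set A : Finset V := {v ∈ X | ¬ H.Adj y v} with hA
  set B : Finset V := {v ∈ Y | ¬ H.Adj x v} with hB
  have hAX : A ⊆ X := filter_subset _ _
  have hBY : B ⊆ Y := filter_subset _ _
  have hBcard : k + #B = n := hYc x
  have hAcard : l + #A = n := hXc y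
  have hAmiss : ∀ a ∈ A, n - k ≤ #{v ∈ Y | ¬ H.Adj a v} := by
    intro a ha
    rw [hA, mem_filter] at ha
    have := hmax a ha.1 y hy (fun h => ha.2 h.symm)
    have := hYc a
    lia
  have hBmiss : ∀ b ∈ B, n - l ≤ #{v ∈ X | ¬ H.Adj v b} := by
    intro b hb
    rw [hB, mem_filter] at hb
    have := hmax x hx b hb.1 hb.2
    have := hXc b
    simp only [H.adj_comm _ b]
    lia
  have hlow : #A * (n - k) ≤ #{e ∈ X ×ˢ Y | ¬ H.Adj e.1 e.2} := by
    calc #A * (n - k) ≤ #{e ∈ A ×ˢ Y | ¬ H.Adj e.1 e.2} := by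
          rw [card_filter_product_eq_sum A Y fun a b => ¬ H.Adj a b, ← smul_eq_mul]
          exact card_nsmul_le_sum _ _ _ hAmiss
      _ ≤ _ := card_le_card (filter_subset_filter _ (product_subset_product_left hAX))
  obtain ⟨hAt, hkt⟩ : #A = t ∧ k = t := by
    have h := hlow.trans hmiss
    obtain ⟨d, hd⟩ : ∃ d, n - k = k + d := ⟨n - k - k, by lia⟩
    obtain ⟨e, he⟩ : ∃ e, k = t + e := ⟨k - t, by lia⟩
    obtain ⟨f, hf⟩ : ∃ f, #A = k + f := ⟨#A - k, by lia⟩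
    have hnt' : n - t = k + d + e := by lia
    rw [hd, hf, hnt', he] at h
    have hn : 0 < #B := card_pos.2 ⟨y, by rw [hB, mem_filter]; exact ⟨hy, hxy⟩⟩
    have : f * (t + e + d) + e * (e + d) ≤ 0 := by nlinarith
    have hpos : 0 < t + e + d := by lia
    have hf0 : f = 0 := by
      by_contra hne
      have := Nat.mul_pos (Nat.pos_of_ne_zero hne) hpos
      lia
    have he0 : e = 0 := by
      by_contra hne
      have := Nat.mul_pos (Nat.pos_of_ne_zero hne) (by lia : 0 < e + d)
      lia
    lia
  have hBt : #B = n - t := by lia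
  refine ⟨A, hAX, B, hBY, hAt, hBt, ?_⟩
  have hsub : {e ∈ X ×ˢ Y | ¬ H.Adj e.1 e.2} ⊆ A ×ˢ B := by
    rintro ⟨a, b⟩ hab
    simp only [mem_filter, mem_product] at hab
    refine mem_product.2 ⟨?_, ?_⟩
    · refine mem_of_forall_le_card_filter (r := fun a b => ¬ H.Adj a b) hAX hAmiss ?_ hab.1.1
        hab.1.2 hab.2
      rwa [hAt, hkt]
    · refine mem_of_forall_le_card_filter (r := fun b a => ¬ H.Adj a b) hBY hBmiss ?_ hab.1.2
        hab.1.1 hab.2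
      rw [card_filter_product_swap X Y fun a b => ¬ H.Adj a b, hBt]
      have : n - l = t := by lia
      rwa [this, mul_comm]
  have heq := eq_of_subset_of_card_le hsub (by
    rw [card_product, hBt]
    calc #A * (n - t) = #A * (n - k) := by rw [hkt]
      _ ≤ _ := hlow)
  intro a ha b hb
  rw [← mem_product (p := (a, b)), ← heq]
  simp [ha, hb]

/-- An enumeration of a set listing a given subset last. -/
theorem exists_equiv_fin_mem_iff [DecidableEq V] {S T : Finset V} {k : ℕ} (hTS : T ⊆ S)
    (hS : #S = n) (hT : #T = k) :
    ∃ e : S ≃ Fin n, ∀ v : S, (v : V) ∈ T ↔ n - k ≤ e v := by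
  let e₀ := S.equivFinOfCardEq hS
  have hkn : k ≤ n := hT ▸ hS ▸ card_le_card hTS
  have hcard : Fintype.card {i : Fin n // (e₀.symm i : V) ∈ T} =
      Fintype.card {i : Fin n // n - k ≤ (i : ℕ)} := by
    have h₁ : Fintype.card {i : Fin n // (e₀.symm i : V) ∈ T} = k := by
      rw [← hT, ← Fintype.card_coe]
      refine Fintype.card_congr ⟨fun i => ⟨_, i.2⟩, fun v => ⟨e₀ ⟨v, hTS v.2⟩, by simp⟩, ?_, ?_⟩
      · intro i; simp
      · intro v; simp
    have h₂ : Fintype.card {i : Fin n // ¬ n - k ≤ (i : ℕ)} = n - k := by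
      simp only [not_le]
      rw [Fintype.card_subtype, Fin.card_filter_val_lt]
      lia
    rw [Fintype.card_subtype_compl, Fintype.card_fin] at h₂
    have h₃ := Fintype.card_subtype_le fun i : Fin n => n - k ≤ (i : ℕ)
    rw [Fintype.card_fin] at h₃
    lia
  let e₁ := (Fintype.equivOfCardEq hcard).extendSubtype
  refine ⟨e₀.trans e₁, fun v => ⟨fun h => ?_, fun h => ?_⟩⟩
  · exact (Fintype.equivOfCardEq hcard).extendSubtype_mem (e₀ v) (by simpa using h)
  · by_contra hv
    exact (Fintype.equivOfCardEq hcard).extendSubtype_not_mem (e₀ v) (by simpa using hv) h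

theorem nonempty_iso_hGraph [Fintype V] [DecidableEq V] (hX : #X = n) (hY : #Y = n)
    (htn : t ≤ n) (hb : H.IsBipartiteWith X Y) (hcover : X ∪ Y = univ) {A B : Finset V}
    (hA : A ⊆ X) (hB : B ⊆ Y) (hAt : #A = t) (hBt : #B = n - t)
    (hadj : ∀ a ∈ X, ∀ b ∈ Y, (H.Adj a b ↔ ¬ (a ∈ A ∧ b ∈ B))) :
    Nonempty (H ≃g HGraph n t) := by
  have hdisj : Disjoint X Y := disjoint_coe.1 hb.disjoint
  obtain ⟨e, he⟩ := exists_equiv_fin_mem_iff hA hX hAt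
  obtain ⟨f, hf⟩ := exists_equiv_fin_mem_iff hB hY hBt
  have hmem : ∀ v, v ∉ Y → v ∈ X := fun v hv => by
    have := mem_univ v
    rw [← hcover, mem_union] at this
    tauto
  have hnmem : ∀ v ∈ X, v ∉ Y := fun v hv => Finset.disjoint_left.1 hdisj hv
  let φ : V → Fin n ⊕ Fin n := fun v =>
    if h : v ∈ Y then .inl (f ⟨v, h⟩) else .inr (e ⟨v, hmem v h⟩)
  have hφY : ∀ v (h : v ∈ Y), φ v = .inl (f ⟨v, h⟩) := fun v h => dif_pos h
  have hφX : ∀ v (h : v ∈ X), φ v = .inr (e ⟨v, h⟩) := fun v h => dif_neg (hnmem v h)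
  have hbij : Function.Bijective φ := by
    constructor
    · intro u v huv
      by_cases hu : u ∈ Y <;> by_cases hv : v ∈ Y
      · rw [hφY u hu, hφY v hv] at huv
        simpa using huv
      · rw [hφY u hu, hφX v (hmem v hv)] at huv
        simp at huv
      · rw [hφX u (hmem u hu), hφY v hv] at huv
        simp at huv
      · rw [hφX u (hmem u hu), hφX v (hmem v hv)] at huv
        simpa using huv
    · rintro (i | i)
      · exact ⟨f.symm i, by rw [hφY _ (f.symm i).2]; simp⟩
      · exact ⟨e.symm i, by rw [hφX _ (e.symm i).2]; simp⟩
  have key : ∀ a ∈ X, ∀ b ∈ Y, ((HGraph n t).Adj (φ b) (φ a) ↔ H.Adj b a) := by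
    intro a ha b hb'
    rw [hφY b hb', hφX a ha, H.adj_comm, hadj a ha b hb']
    have h₁ := he ⟨a, ha⟩
    have h₂ := hf ⟨b, hb'⟩
    simp only [HGraph, fromRel_adj] at *
    rw [h₁, h₂]
    simp
    lia
  refine ⟨Equiv.ofBijective φ hbij, ?_⟩
  intro u v
  simp only [Equiv.ofBijective_apply]
  by_cases hu : u ∈ Y <;> by_cases hv : v ∈ Y
  · rw [hφY u hu, hφY v hv]
    refine iff_of_false (by simp [HGraph]) fun h => ?_
    rcases hb.mem_of_adj h with h | h
    · exact hnmem _ h.1 hu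
    · exact hnmem _ h.2 hv
  · exact key v (hmem v hv) u hu
  · rw [adj_comm, H.adj_comm]
    exact key u (hmem u hu) v hv
  · rw [hφX u (hmem u hu), hφX v (hmem v hv)]
    refine iff_of_false (by simp [HGraph]) fun h => ?_
    rcases hb.mem_of_adj h with h | h
    · exact hv h.2
    · exact hu h.1

theorem IsBipartiteWith.sup_edge (hb : H.IsBipartiteWith X Y) (hx : x ∈ X) (hy : y ∈ Y) :
    (H ⊔ edge x y).IsBipartiteWith X Y where
  disjoint := hb.disjoint
  mem_of_adj := by
    intro u v h
    rcases h with h | h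
    · exact hb.mem_of_adj h
    · rw [edge_adj] at h
      rcases h with ⟨⟨rfl, rfl⟩ | ⟨rfl, rfl⟩, -⟩
      · exact .inl ⟨hx, hy⟩
      · exact .inr ⟨hy, hx⟩

/-- In an edge-maximal non-Hamiltonian balanced bipartite graph of minimum degree at least `t`
with at most `t (n - t)` missing edges, the missing edges form a complete bipartite graph
between sets of sizes `t` and `n - t`. -/
theorem exists_forall_adj_iff_of_maximal [Fintype V] [DecidableEq V] [DecidableRel H.Adj]
    (hX : #X = n) (hY : #Y = n) (ht : 1 ≤ t) (hnt : 2 * t ≤ n) (hcover : X ∪ Y = univ)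
    (hH : Maximal (fun K : SimpleGraph V => K.IsBipartiteWith X Y ∧ ¬ K.IsHamiltonian) H)
    (hδX : ∀ v ∈ X, t ≤ #{w ∈ Y | H.Adj v w}) (hδY : ∀ v ∈ Y, t ≤ #{w ∈ X | H.Adj v w})
    (hmiss : #{e ∈ X ×ˢ Y | ¬ H.Adj e.1 e.2} ≤ t * (n - t)) :
    (∃ A ⊆ X, ∃ B ⊆ Y, #A = t ∧ #B = n - t ∧
      ∀ a ∈ X, ∀ b ∈ Y, (H.Adj a b ↔ ¬ (a ∈ A ∧ b ∈ B))) ∨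
    (∃ A ⊆ Y, ∃ B ⊆ X, #A = t ∧ #B = n - t ∧
      ∀ a ∈ Y, ∀ b ∈ X, (H.Adj a b ↔ ¬ (a ∈ A ∧ b ∈ B))) := by
  obtain ⟨hb, hham⟩ := hH.prop
  have hdisj : Disjoint X Y := disjoint_coe.1 hb.disjoint
  have hcard : Fintype.card V = 2 * n := by
    rw [← card_univ, ← hcover, card_union_of_disjoint hdisj]; lia
  have hne : ({e ∈ X ×ˢ Y | ¬ H.Adj e.1 e.2} : Finset (V × V)).Nonempty := by
    by_contra h
    refine hham (.of_forall_adj hX hY (by lia) hdisj hcover fun a ha b hb => ?_)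
    by_contra hab
    exact h ⟨(a, b), by simp [ha, hb, hab]⟩
  obtain ⟨⟨x, y⟩, hxy, hmax⟩ := exists_max_image _
    (fun e : V × V => #{v ∈ Y | H.Adj e.1 v} + #{v ∈ X | H.Adj e.2 v}) hne
  simp only [mem_filter, mem_product, and_imp, Prod.forall] at hxy hmax
  obtain ⟨⟨hx, hy⟩, hxy⟩ := hxy
  have hxy' : x ≠ y := fun h => Finset.disjoint_left.1 hdisj hx (h ▸ hy)
  have hadd : (H ⊔ edge x y).IsHamiltonian := by
    by_contra h
    exact (H.lt_sup_edge _ _ hxy' hxy).not_ge (hH.le_of_ge ⟨hb.sup_edge hx hy, h⟩ le_sup_left)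
  obtain ⟨p, hp⟩ := exists_isHamiltonian_walk_of_sup_edge hham hxy' hadd
  have hsum := card_add_card_le_of_isHamiltonian_walk hham (by lia) hb hp
  rw [hX] at hsum
  rcases le_total #{v ∈ Y | H.Adj x v} #{v ∈ X | H.Adj y v} with hle | hle
  · exact .inl (exists_forall_adj_iff_of_card_le hX hY hx hy hxy hsum
      (fun a ha b hb hab => hmax a b ha hb hab) hle (hδX x hx) hmiss)
  · refine .inr (exists_forall_adj_iff_of_card_le hY hX hy hx (fun h => hxy h.symm)
      (by lia) (fun a ha b hb hab => ?_) hle (hδY y hy) ?_)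
    · have := hmax b a hb ha fun h => hab h.symm
      lia
    · rwa [card_filter_not_adj_swap]

theorem IsBipartiteWith.filter_adj_eq_neighborFinset [Fintype V] [DecidableEq V]
    [DecidableRel H.Adj] (hb : H.IsBipartiteWith X Y) {v : V} (hv : v ∈ X) :
    ({w ∈ Y | H.Adj v w} : Finset V) = H.neighborFinset v := by
  ext w
  simp only [mem_filter, mem_neighborFinset, and_iff_right_iff_imp]
  intro h
  rcases hb.mem_of_adj h with h | h
  · exact h.2
  · exact absurd h.1 (Finset.disjoint_left.1 (disjoint_coe.1 hb.disjoint) hv)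

theorem IsBipartiteWith.card_edgeFinset_add_card_not_adj [Fintype V] [DecidableEq V]
    [DecidableRel H.Adj] (hb : H.IsBipartiteWith X Y) :
    #H.edgeFinset + #{e ∈ X ×ˢ Y | ¬ H.Adj e.1 e.2} = #X * #Y := by
  rw [← isBipartiteWith_sum_degrees_eq_card_edges hb, ← card_product,
    ← card_filter_add_card_filter_not (s := X ×ˢ Y) fun e => H.Adj e.1 e.2,
    card_filter_product_eq_sum X Y H.Adj]
  congr 1
  refine sum_congr rfl fun v hv => ?_
  rw [hb.filter_adj_eq_neighborFinset hv, card_neighborFinset_eq_degree]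

end SimpleGraph

/-- Moon–Moser type theorem (Lemma 1): a balanced bipartite graph with |X| = |Y| = n ≥ 2t,
minimum degree ≥ t ≥ 1 and at least n² - tn + t² edges is Hamiltonian unless it is H_{t,n-t}. -/
theorem stmt_0 {V : Type*} [Fintype V] [DecidableEq V] (G : SimpleGraph V) [DecidableRel G.Adj]
    (n t : ℕ) (ht : 1 ≤ t) (hnt : 2 * t ≤ n)
    (X Y : Finset V) (hX : X.card = n) (hY : Y.card = n)
    (hdisj : Disjoint X Y) (hcover : X ∪ Y = Finset.univ)
    (hbip : ∀ u v : V, G.Adj u v → (u ∈ X ∧ v ∈ Y) ∨ (u ∈ Y ∧ v ∈ X))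
    (hδ : ∀ v : V, t ≤ G.degree v)
    (hm : (n : ℝ) ^ 2 - t * n + t ^ 2 ≤ (G.edgeFinset.card : ℝ)) :
    G.IsHamiltonian ∨ Nonempty (G ≃g HGraph n t) := by
  classical
  by_cases hham : G.IsHamiltonian
  · exact .inl hham
  right
  have hb : G.IsBipartiteWith X Y := ⟨disjoint_coe.2 hdisj, fun u v h => hbip u v h⟩
  have hmissG : #{e ∈ X ×ˢ Y | ¬ G.Adj e.1 e.2} ≤ t * (n - t) := by
    have h := hb.card_edgeFinset_add_card_not_adj
    rw [hX, hY] at h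
    have h' : (#G.edgeFinset : ℝ) + #{e ∈ X ×ˢ Y | ¬ G.Adj e.1 e.2} = n * n := by
      exact_mod_cast h
    have : (#{e ∈ X ×ˢ Y | ¬ G.Adj e.1 e.2} : ℝ) ≤ ((t * (n - t) : ℕ) : ℝ) := by
      push_cast [Nat.cast_sub (by lia : t ≤ n)]
      nlinarith
    exact_mod_cast this
  obtain ⟨H, hGH, hH⟩ := (Set.toFinite {K : SimpleGraph V | K.IsBipartiteWith X Y ∧
    ¬ K.IsHamiltonian}).exists_le_maximal (a := G) ⟨hb, hham⟩
  have hsub : ({e ∈ X ×ˢ Y | ¬ H.Adj e.1 e.2} : Finset (V × V)) ⊆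
      {e ∈ X ×ˢ Y | ¬ G.Adj e.1 e.2} := monotone_filter_right _ fun e _ h h' => h (hGH h')
  have hdeg : ∀ {S T : Finset V}, G.IsBipartiteWith S T → ∀ v ∈ S, t ≤ #{w ∈ T | H.Adj v w} := by
    intro S T hST v hv
    refine ((hδ v).trans_eq ?_).trans
      (card_le_card (monotone_filter_right T fun w _ (h : G.Adj v w) => hGH h))
    rw [hST.filter_adj_eq_neighborFinset hv, card_neighborFinset_eq_degree]
  have heq : ∀ {S T A B : Finset V}, #S = n → #T = n → G.IsBipartiteWith S T → S ∪ T = univ →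
      #{e ∈ S ×ˢ T | ¬ G.Adj e.1 e.2} ≤ t * (n - t) → A ⊆ S → B ⊆ T → #A = t → #B = n - t →
      (∀ a ∈ S, ∀ b ∈ T, (H.Adj a b ↔ ¬ (a ∈ A ∧ b ∈ B))) → Nonempty (G ≃g HGraph n t) := by
    intro S T A B hS hT hST hcov hmiss hA hB hAt hBt hadj
    have hAB : A ×ˢ B ⊆ {e ∈ S ×ˢ T | ¬ G.Adj e.1 e.2} := by
      rintro ⟨a, b⟩ h
      rw [mem_product] at h
      have hnot := (hadj a (hA h.1) b (hB h.2)).not_left.2 h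
      simp only [mem_filter, mem_product]
      exact ⟨⟨hA h.1, hB h.2⟩, fun h => hnot (hGH h)⟩
    have hAB' := eq_of_subset_of_card_le hAB (by rwa [card_product, hAt, hBt])
    refine nonempty_iso_hGraph hS hT (by lia) hST hcov hA hB hAt hBt fun a ha b hb => ?_
    rw [← mem_product (p := (a, b)), hAB']
    simp [ha, hb]
  rcases exists_forall_adj_iff_of_maximal hX hY ht hnt hcover hH (hdeg hb) (hdeg hb.symm)
    ((card_le_card hsub).trans hmissG) with ⟨A, hA, B, hB, hAt, hBt, h⟩ | ⟨A, hA, B, hB, hAt, hBt, h⟩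
  · exact heq hX hY hb hcover hmissG hA hB hAt hBt h
  · exact heq hY hX hb.symm (by rw [union_comm, hcover])
      (by rwa [card_filter_not_adj_swap]) hA hB hAt hBt h
end

section
/- Let G = G[X,Y] be a connected bipartite graph with bipartition (X,Y), |X| = |Y| = n ≥ 2t, minimum degree δ(G) ≥ t (where t ≥ 1), and m edges. If ρ_D(G) ≤ m − n² + (t+6)n − (t² + 4), then G is Hamiltonian unless G is isomorphic to H_{t,n−t}. -/
open SimpleGraph Finset

namespace SimpleGraph

variable {V : Type*}

lemma exists_alternating_path [DecidableEq V] {G : SimpleGraph V} {X Y : Finset V}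
    (hdisj : Disjoint X Y) (hadj : ∀ a ∈ X, ∀ b ∈ Y, G.Adj a b) (k : ℕ) :
    ∀ A ⊆ X, ∀ B ⊆ Y, #A = k + 1 → #B = k + 1 →
      ∃ a ∈ A, ∃ b ∈ B, ∃ p : G.Walk a b, p.IsPath ∧ ∀ w, w ∈ p.support ↔ w ∈ A ∨ w ∈ B := by
  induction k with
  | zero =>
    intro A hAX B hBY hA hB
    obtain ⟨a, rfl⟩ := Finset.card_eq_one.mp hA
    obtain ⟨b, rfl⟩ := Finset.card_eq_one.mp hB
    have hab : G.Adj a b := hadj a (by simpa using hAX) b (by simpa using hBY)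
    refine ⟨a, by simp, b, by simp, hab.toWalk, Walk.IsPath.of_adj hab, fun w ↦ ?_⟩
    simp
  | succ k ih =>
    intro A hAX B hBY hA hB
    obtain ⟨a, A', ha, rfl, hA'⟩ := Finset.card_eq_succ.mp hA
    obtain ⟨b, B', hb, rfl, hB'⟩ := Finset.card_eq_succ.mp hB
    rw [Finset.insert_subset_iff] at hAX hBY
    obtain ⟨a', ha', b', hb', p, hp, hsupp⟩ := ih A' hAX.2 B' hBY.2 hA' hB'
    have hne := fun u hu v hv ↦ Finset.disjoint_iff_ne.mp hdisj u hu v hv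
    refine ⟨a, by simp, b', by simp [hb'], Walk.cons (hadj a hAX.1 b hBY.1)
      (Walk.cons (hadj a' (hAX.2 ha') b hBY.1).symm p), ?_, fun w ↦ ?_⟩
    · rw [Walk.cons_isPath_iff, Walk.cons_isPath_iff, Walk.support_cons, List.mem_cons, hsupp,
        hsupp]
      have h1 : b ∉ A' := fun h ↦ hne b (hAX.2 h) b hBY.1 rfl
      have h2 : a ∉ B' := fun h ↦ hne a hAX.1 a (hBY.2 h) rfl
      have h3 : a ≠ b := hne a hAX.1 b hBY.1
      tauto
    · simp only [Walk.support_cons, List.mem_cons, hsupp, Finset.mem_insert]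
      tauto

section Hamiltonian

variable [Fintype V] [DecidableEq V] {G : SimpleGraph V}

lemma isHamiltonian_of_isHamiltonian_path (hV : 3 ≤ Fintype.card V) {u v : V} {p : G.Walk u v}
    (hp : p.IsHamiltonian) (h : G.Adj v u) : G.IsHamiltonian := by
  refine fun _ ↦ ⟨v, Walk.cons h p, ?_⟩
  have hl := hp.length_eq
  rw [Walk.isHamiltonianCycle_iff_isCycle_and_length_eq,
    Walk.isCycle_iff_isPath_tail_and_le_length]
  refine ⟨⟨by simpa using hp.isPath, ?_⟩, ?_⟩ <;> rw [Walk.length_cons] <;> omega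

/-- Breaking a Hamiltonian path at a pair of consecutive vertices `p i, p (i + 1)` such that
`p i` is adjacent to the end and `p (i + 1)` to the start yields a Hamiltonian cycle. -/
lemma Walk.IsHamiltonian.isHamiltonian_of_crossing (hV : 3 ≤ Fintype.card V) {x y : V}
    {p : G.Walk x y} (hp : p.IsHamiltonian) {i : ℕ} (hi : i < p.length)
    (hx : G.Adj x (p.getVert (i + 1))) (hy : G.Adj y (p.getVert i)) : G.IsHamiltonian := by
  refine isHamiltonian_of_isHamiltonian_path hV
    (p := (p.drop (i + 1)).append (Walk.cons hy (p.take i).reverse)) (fun a ↦ ?_) hx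
  have h := hp a
  rw [← List.take_append_drop (i + 1) p.support, List.count_append] at h
  rw [Walk.support_append, Walk.support_cons, List.tail_cons, Walk.support_reverse,
    List.count_append, List.count_reverse, Walk.support_take, Walk.drop_support_eq_support_drop_min,
    min_eq_left (by omega), add_comm]
  exact h

lemma Walk.IsHamiltonian.degree_add_degree_le [DecidableRel G.Adj] (hV : 3 ≤ Fintype.card V)
    {X Y : Finset V} (hG : G.IsBipartiteWith X Y) {x y : V} (hx : x ∈ X) (hy : y ∈ Y)
    {p : G.Walk x y} (hp : p.IsHamiltonian) (hnot : ¬ G.IsHamiltonian) :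
    G.degree x + G.degree y ≤ #X := by
  set I := (Finset.range p.length).filter fun i ↦ G.Adj x (p.getVert (i + 1)) with hI
  have hdeg : G.degree x ≤ #I := by
    rw [← card_neighborFinset_eq_degree]
    refine (Finset.card_le_card (t := I.image fun i ↦ p.getVert (i + 1)) fun u hu ↦ ?_).trans
      Finset.card_image_le
    rw [mem_neighborFinset] at hu
    obtain ⟨j, hj, hjl⟩ := Walk.mem_support_iff_exists_getVert.mp (hp.mem_support u)
    obtain _ | j := j
    · rw [Walk.getVert_zero] at hj
      exact (G.ne_of_adj hu hj).elim
    · simp only [hI, Finset.mem_image, Finset.mem_filter, Finset.mem_range]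
      exact ⟨j, ⟨by omega, hj ▸ hu⟩, hj⟩
  have hcard : #(I.image p.getVert) = #I := by
    refine Finset.card_image_of_injOn fun i hi j hj hij ↦ ?_
    simp only [hI, Finset.coe_filter, Finset.mem_range, Set.mem_ofPred_eq] at hi hj
    exact hp.isPath.getVert_injOn (by simp; omega) (by simp; omega) hij
  have hdisj : Disjoint (I.image p.getVert) (G.neighborFinset y) := by
    refine Finset.disjoint_left.mpr fun u hu hyu ↦ hnot ?_
    simp only [hI, Finset.mem_image, Finset.mem_filter, Finset.mem_range] at hu
    obtain ⟨i, ⟨hi, hadj⟩, rfl⟩ := hu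
    exact hp.isHamiltonian_of_crossing hV hi hadj (by simpa using hyu)
  have hsub : I.image p.getVert ∪ G.neighborFinset y ⊆ X := by
    refine Finset.union_subset (fun u hu ↦ ?_) (isBipartiteWith_neighborFinset_subset' hG hy)
    simp only [hI, Finset.mem_image, Finset.mem_filter, Finset.mem_range] at hu
    obtain ⟨i, ⟨hi, hadj⟩, rfl⟩ := hu
    exact hG.symm.mem_of_mem_adj (hG.mem_of_mem_adj hx hadj) (p.adj_getVert_succ hi).symm
  have := Finset.card_le_card hsub
  rw [Finset.card_union_of_disjoint hdisj, hcard, card_neighborFinset_eq_degree] at this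
  omega

lemma exists_isHamiltonian_path_of_sup_edge [Nontrivial V] {x y : V}
    (hG : (G ⊔ edge x y).IsHamiltonian) (hnot : ¬ G.IsHamiltonian) :
    ∃ p : G.Walk x y, p.IsHamiltonian := by
  obtain ⟨c, hc⟩ := hG.exists_isHamiltonianCycle x
  have hadj {e : Sym2 V} (he : e ∈ (G ⊔ edge x y).edgeSet) (hne : e ≠ s(x, y)) :
      e ∈ G.edgeSet := by
    induction e with | h a b
    rw [mem_edgeSet, sup_adj, edge_adj] at he
    rw [ne_eq, Sym2.eq_iff] at hne
    rw [mem_edgeSet]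
    tauto
  by_cases hmem : s(x, y) ∈ c.edges
  · obtain ⟨d, hd, hsnd⟩ : ∃ d : (G ⊔ edge x y).Walk x x, d.IsHamiltonianCycle ∧ d.snd = y := by
      have hy : y ∈ c.toSubgraph.neighborSet x := by
        rwa [Subgraph.mem_neighborSet, ← Subgraph.mem_edgeSet, Walk.mem_edges_toSubgraph]
      rw [hc.isCycle.neighborSet_toSubgraph_endpoint] at hy
      obtain hy | hy := hy
      · exact ⟨c, hc, hy.symm⟩
      · refine ⟨c.reverse, ?_, (Walk.snd_reverse c).trans hy.symm⟩
        rw [Walk.isHamiltonianCycle_iff_isCycle_and_length_eq] at hc ⊢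
        exact ⟨hc.1.reverse, by rw [Walk.length_reverse, hc.2]⟩
    cases d with
    | nil => exact (hd.not_nil Walk.Nil.nil).elim
    | cons h p =>
      rw [Walk.snd_cons] at hsnd
      subst hsnd
      have hp := ((Walk.cons_isCycle_iff p h).mp hd.isCycle).2
      have hham : p.IsHamiltonian := by
        have := hd.length_eq
        rw [Walk.length_cons] at this
        exact Walk.isHamiltonian_iff_isPath_and_length_eq.mpr
          ⟨((Walk.cons_isCycle_iff p h).mp hd.isCycle).1, by omega⟩
      refine ⟨(p.transfer G fun e he ↦ hadj (p.edges_subset_edgeSet he) ?_).reverse, fun a ↦ ?_⟩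
      · rintro rfl
        exact hp he
      · rw [Walk.support_reverse, List.count_reverse, Walk.support_transfer]
        exact hham a
  · refine (hnot fun _ ↦ ⟨x, c.transfer G fun e he ↦ hadj (c.edges_subset_edgeSet he) ?_, ?_⟩).elim
    · rintro rfl
      exact hmem he
    · rw [Walk.isHamiltonianCycle_iff_isCycle_and_length_eq] at hc ⊢
      exact ⟨hc.1.transfer _, by rw [Walk.length_transfer, hc.2]⟩

lemma isHamiltonian_of_forall_adj {X Y : Finset V} (hdisj : Disjoint X Y)
    (hcover : X ∪ Y = Finset.univ) (hcard : #X = #Y) (hX : 2 ≤ #X)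
    (hadj : ∀ a ∈ X, ∀ b ∈ Y, G.Adj a b) : G.IsHamiltonian := by
  obtain ⟨a, ha, b, hb, p, hp, hsupp⟩ := exists_alternating_path hdisj hadj (#X - 1) X subset_rfl
    Y subset_rfl (by omega) (by omega)
  refine isHamiltonian_of_isHamiltonian_path (p := p) ?_
    (hp.isHamiltonian_of_mem fun w ↦ (hsupp w).mpr ?_) (hadj a ha b hb).symm
  · rw [← Finset.card_univ, ← hcover, Finset.card_union_of_disjoint hdisj]
    omega
  · rw [← Finset.mem_union, hcover]
    exact Finset.mem_univ w

/-- If `x` is a vertex all of whose non-neighbours `y` on the other side satisfy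
`deg x + deg y ≤ n`, then the number of edges is at most `k n + (n - k) ^ 2` for `k = deg x`. -/
lemma IsBipartiteWith.card_edgeFinset_le [DecidableRel G.Adj] {X Y : Finset V} {n : ℕ}
    (hG : G.IsBipartiteWith X Y) (hX : #X = n) (hY : #Y = n) {x : V} (hx : x ∈ X)
    (h : ∀ y ∈ Y, ¬ G.Adj x y → G.degree x + G.degree y ≤ n) :
    #G.edgeFinset ≤ G.degree x * n + (n - G.degree x) ^ 2 := by
  have hsub := isBipartiteWith_neighborFinset_subset hG hx
  rw [← isBipartiteWith_sum_degrees_eq_card_edges' hG, ← Finset.sum_sdiff hsub, add_comm]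
  refine add_le_add ?_ ?_
  · refine (Finset.sum_le_card_nsmul _ _ n fun y hy ↦ ?_).trans_eq ?_
    · exact (isBipartiteWith_degree_le' hG (hsub hy)).trans_eq hX
    · rw [card_neighborFinset_eq_degree, smul_eq_mul]
  · refine (Finset.sum_le_card_nsmul _ _ (n - G.degree x) fun y hy ↦ ?_).trans_eq ?_
    · rw [Finset.mem_sdiff, mem_neighborFinset] at hy
      have := h y hy.1 hy.2
      omega
    · rw [Finset.card_sdiff_of_subset hsub, card_neighborFinset_eq_degree, hY, smul_eq_mul, sq]

/-- The Moon–Moser theorem: a balanced bipartite graph with minimum degree at least `t` and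
more than `n (n - t) + t ^ 2` edges is Hamiltonian. -/
theorem IsBipartiteWith.isHamiltonian_of_lt_card_edgeFinset [DecidableRel G.Adj] {X Y : Finset V}
    {n t : ℕ} (hG : G.IsBipartiteWith X Y) (hcover : X ∪ Y = Finset.univ) (hX : #X = n)
    (hY : #Y = n) (hn : 2 ≤ n) (hnt : 2 * t ≤ n) (hδ : ∀ v, t ≤ G.degree v)
    (hm : n * (n - t) + t ^ 2 < #G.edgeFinset) : G.IsHamiltonian := by
  classical
  by_contra hnot
  have hdisj : Disjoint X Y := by exact_mod_cast hG.disjoint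
  have hV : Fintype.card V = n + n := by
    rw [← Finset.card_univ, ← hcover, Finset.card_union_of_disjoint hdisj, hX, hY]
  have : Nontrivial V := Fintype.one_lt_card_iff_nontrivial.mp (by omega)
  obtain ⟨K, hGK, hK⟩ := Finite.exists_le_maximal
    (p := fun K : SimpleGraph V ↦ K.IsBipartiteWith X Y ∧ ¬ K.IsHamiltonian) ⟨hG, hnot⟩
  obtain ⟨⟨hKb, hKnot⟩, hmax⟩ := hK
  have hore {x y : V} (hx : x ∈ X) (hy : y ∈ Y) (hxy : ¬ K.Adj x y) :
      K.degree x + K.degree y ≤ n := by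
    have hne : x ≠ y := Finset.disjoint_iff_ne.mp hdisj x hx y hy
    have hham : (K ⊔ edge x y).IsHamiltonian := by
      by_contra hcon
      refine hxy (hmax ⟨⟨hKb.disjoint, fun v w hvw ↦ ?_⟩, hcon⟩ le_sup_left
        (Or.inr ((edge_adj ..).mpr ⟨Or.inl ⟨rfl, rfl⟩, hne⟩)))
      rw [sup_adj, edge_adj] at hvw
      obtain hvw | ⟨⟨rfl, rfl⟩ | ⟨rfl, rfl⟩, -⟩ := hvw
      · exact hKb.mem_of_adj hvw
      · exact Or.inl ⟨hx, hy⟩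
      · exact Or.inr ⟨hy, hx⟩
    obtain ⟨p, hp⟩ := exists_isHamiltonian_path_of_sup_edge hham hKnot
    exact hX ▸ hp.degree_add_degree_le (by omega) hKb hx hy hKnot
  obtain ⟨x, hx, y, hy, hxy⟩ : ∃ x ∈ X, ∃ y ∈ Y, ¬ K.Adj x y := by
    by_contra! hcon
    exact hKnot (isHamiltonian_of_forall_adj hdisj hcover (hX.trans hY.symm) (hX ▸ hn) hcon)
  have hmK : #G.edgeFinset ≤ #K.edgeFinset := Finset.card_le_card (edgeFinset_mono hGK)
  have hδK (v : V) : t ≤ K.degree v := (hδ v).trans (degree_le_of_le hGK)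
  have key {k : ℕ} (htk : t ≤ k) (hkn : 2 * k ≤ n)
      (hle : #K.edgeFinset ≤ k * n + (n - k) ^ 2) : False := by
    obtain ⟨a, rfl⟩ := Nat.exists_eq_add_of_le htk
    obtain ⟨b, rfl⟩ := Nat.exists_eq_add_of_le hkn
    have h1 : 2 * (t + a) + b - t = t + 2 * a + b := by omega
    have h2 : 2 * (t + a) + b - (t + a) = t + a + b := by omega
    rw [h1] at hm
    rw [h2] at hle
    nlinarith [Nat.zero_le (a * a), Nat.zero_le (a * b)]
  have hsum := hore hx hy hxy
  obtain h | h : 2 * K.degree x ≤ n ∨ 2 * K.degree y ≤ n := by omega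
  · exact key (hδK x) h (hKb.card_edgeFinset_le hX hY hx fun y hy hxy ↦ hore hx hy hxy)
  · exact key (hδK y) h (hKb.symm.card_edgeFinset_le hY hX hy fun x hx hxy ↦ by
      rw [add_comm]
      exact hore hx hy fun h ↦ hxy h.symm)

end Hamiltonian

section Distance

variable {G : SimpleGraph V} {X Y : Set V} {u v : V}

lemma Connected.two_le_dist (hconn : G.Connected) (hne : u ≠ v) (hadj : ¬ G.Adj u v) :
    2 ≤ G.dist u v := by
  have h0 := hconn.pos_dist_of_ne hne
  have h1 := mt dist_eq_one_iff_adj.mp hadj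
  omega

lemma IsBipartiteWith.three_le_dist (hG : G.IsBipartiteWith X Y) (hconn : G.Connected)
    (hu : u ∈ X) (hv : v ∈ Y) (hadj : ¬ G.Adj u v) : 3 ≤ G.dist u v := by
  obtain ⟨p, hp⟩ := hconn.exists_walk_length_eq_dist u v
  rw [← hp]
  match p with
  | .nil => exact (Set.disjoint_left.mp hG.disjoint hu hv).elim
  | .cons h .nil => exact (hadj h).elim
  | .cons h (.cons h' .nil) =>
    exact (Set.disjoint_left.mp hG.disjoint (hG.symm.mem_of_mem_adj (hG.mem_of_mem_adj hu h) h')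
      hv).elim
  | .cons _ (.cons _ (.cons _ _)) => simp

lemma IsBipartiteWith.le_transmission [Fintype V] [DecidableEq V] [DecidableRel G.Adj]
    {X Y : Finset V} {n : ℕ} (hG : G.IsBipartiteWith X Y) (hconn : G.Connected)
    (hcover : X ∪ Y = Finset.univ) (hX : #X = n) (hY : #Y = n) {u : V} (hu : u ∈ X) :
    5 * n ≤ transmission G u + 2 * G.degree u + 2 := by
  have hdisj : Disjoint X Y := by exact_mod_cast hG.disjoint
  have h1 : 2 * n ≤ ∑ v ∈ X, G.dist u v + 2 := by
    calc 2 * n = ∑ v ∈ X, 2 := by simp [hX, mul_comm]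
      _ ≤ ∑ v ∈ X, (G.dist u v + if u = v then 2 else 0) := by
        refine Finset.sum_le_sum fun v hv ↦ ?_
        split_ifs with h
        · omega
        · exact hconn.two_le_dist h fun hadj ↦
            Finset.disjoint_left.mp hdisj hv (hG.mem_of_mem_adj hu hadj)
      _ = _ := by rw [Finset.sum_add_distrib, Finset.sum_ite_eq, if_pos hu]
  have h2 : 3 * n ≤ ∑ v ∈ Y, G.dist u v + 2 * G.degree u := by
    calc 3 * n = ∑ v ∈ Y, 3 := by simp [hY, mul_comm]
      _ ≤ ∑ v ∈ Y, (G.dist u v + if G.Adj u v then 2 else 0) := by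
        refine Finset.sum_le_sum fun v hv ↦ ?_
        split_ifs with h
        · have := dist_eq_one_iff_adj.mpr h
          omega
        · exact hG.three_le_dist hconn hu hv h
      _ = _ := by
        rw [Finset.sum_add_distrib, ← Finset.sum_filter, Finset.sum_const, smul_eq_mul,
          ← isBipartiteWith_neighborFinset hG hu, card_neighborFinset_eq_degree, mul_comm 2]
  rw [transmission, ← hcover, Finset.sum_union hdisj]
  omega

end Distance

end SimpleGraph

lemma sum_distSignlessLaplacian {V : Type*} [Fintype V] [DecidableEq V] (G : SimpleGraph V) :
    ∑ u, ∑ v, distSignlessLaplacian G u v = 2 * ∑ u, (transmission G u : ℝ) := by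
  simp_rw [distSignlessLaplacian, Finset.sum_add_distrib, Finset.sum_ite_eq, Finset.mem_univ,
    if_true, transmission, Nat.cast_sum, two_mul]

lemma distSignlessLaplacian_isHermitian {V : Type*} [Fintype V] [DecidableEq V]
    (G : SimpleGraph V) : (distSignlessLaplacian G).IsHermitian := by
  ext u v
  rw [Matrix.conjTranspose_apply, star_trivial, distSignlessLaplacian, distSignlessLaplacian,
    SimpleGraph.dist_comm]
  congr 1
  by_cases h : u = v
  · subst h; rfl
  · rw [if_neg h, if_neg (Ne.symm h)]

/-- The sum of the entries of a symmetric real matrix is at most its order times any upper bound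
for its eigenvalues. -/
lemma Matrix.IsHermitian.sum_le_card_mul {ι : Type*} [Fintype ι] [DecidableEq ι]
    {A : Matrix ι ι ℝ} (hA : A.IsHermitian) {ρ : ℝ}
    (hρ : ρ ∈ upperBounds {μ : ℝ | Module.End.HasEigenvalue (Matrix.toLin' A) μ}) :
    ∑ i, ∑ j, A i j ≤ Fintype.card ι * ρ := by
  have hB : (ρ • (1 : Matrix ι ι ℝ) - A).IsHermitian := by
    refine Matrix.IsHermitian.sub ?_ hA
    rw [Matrix.IsHermitian, Matrix.conjTranspose_smul, Matrix.conjTranspose_one, star_trivial]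
  have hpos : (ρ • (1 : Matrix ι ι ℝ) - A).PosSemidef := by
    rw [hB.posSemidef_iff_eigenvalues_nonneg]
    intro j
    have hj := hB.mulVec_eigenvectorBasis j
    rw [Matrix.sub_mulVec, Matrix.smul_mulVec, Matrix.one_mulVec] at hj
    have hev : Module.End.HasEigenvalue (Matrix.toLin' A) (ρ - hB.eigenvalues j) := by
      refine Module.End.hasEigenvalue_of_hasEigenvector (x := ⇑(hB.eigenvectorBasis j))
        ⟨Module.End.mem_eigenspace_iff.mpr ?_, fun h ↦ ?_⟩
      · rw [Matrix.toLin'_apply, sub_smul, ← hj]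
        abel
      · exact hB.eigenvectorBasis.orthonormal.ne_zero j (by ext i; exact congrFun h i)
    have := hρ hev
    simp only [Pi.zero_apply]
    linarith
  have h := hpos.dotProduct_mulVec_nonneg 1
  rw [Matrix.sub_mulVec, Matrix.smul_mulVec, Matrix.one_mulVec, dotProduct_sub] at h
  simp [dotProduct, Matrix.mulVec] at h
  linarith

/-- Theorem 3: spectral condition for a balanced bipartite graph to be Hamiltonian
unless it is H_{t,n-t}. -/
theorem stmt_2 {V : Type*} [Fintype V] [DecidableEq V] (G : SimpleGraph V) [DecidableRel G.Adj]
    (hconn : G.Connected)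
    (n t : ℕ) (ht : 1 ≤ t) (hnt : 2 * t ≤ n)
    (X Y : Finset V) (hX : X.card = n) (hY : Y.card = n)
    (hdisj : Disjoint X Y) (hcover : X ∪ Y = Finset.univ)
    (hbip : ∀ u v : V, G.Adj u v → (u ∈ X ∧ v ∈ Y) ∨ (u ∈ Y ∧ v ∈ X))
    (hδ : ∀ v : V, t ≤ G.degree v)
    (ρ : ℝ) (hρ : IsDistSLSpectralRadius G ρ)
    (hle : ρ ≤ (G.edgeFinset.card : ℝ) - (n : ℝ) ^ 2 + ((t : ℝ) + 6) * n - ((t : ℝ) ^ 2 + 4)) :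
    G.IsHamiltonian ∨ Nonempty (G ≃g HGraph n t) := by
  left
  have hG : G.IsBipartiteWith X Y := ⟨by exact_mod_cast hdisj, fun u v h ↦ hbip u v h⟩
  have hV : Fintype.card V = n + n := by
    rw [← Finset.card_univ, ← hcover, Finset.card_union_of_disjoint hdisj, hX, hY]
  refine hG.isHamiltonian_of_lt_card_edgeFinset hcover hX hY (by omega) hnt hδ ?_
  have htr (u : V) : 5 * n ≤ transmission G u + 2 * G.degree u + 2 := by
    obtain hu | hu := Finset.mem_union.mp (hcover ▸ Finset.mem_univ u : u ∈ X ∪ Y)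
    · exact hG.le_transmission hconn hcover hX hY hu
    · exact hG.symm.le_transmission hconn (Finset.union_comm X Y ▸ hcover) hY hX hu
  have hsum : (n + n) * (5 * n) ≤
      ∑ u, transmission G u + 2 * (2 * G.edgeFinset.card) + (n + n) * 2 := by
    have := Finset.sum_le_sum fun u (_ : u ∈ Finset.univ) ↦ htr u
    rw [Finset.sum_add_distrib, Finset.sum_add_distrib, ← Finset.mul_sum (f := fun u ↦ G.degree u),
      sum_degrees_eq_twice_card_edges] at this
    simpa [hV] using this
  have hray := (distSignlessLaplacian_isHermitian G).sum_le_card_mul hρ.2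
  rw [sum_distSignlessLaplacian, hV] at hray
  have htn : t ≤ n := by omega
  have hn0 : (0 : ℝ) < n := by exact_mod_cast (by omega : 0 < n)
  have ht0 : (0 : ℝ) < t := by exact_mod_cast ht
  have hlt : (t : ℝ) < n := by exact_mod_cast (by omega : t < n)
  have hsumR : ((n : ℝ) + n) * (5 * n) ≤
      ∑ u, (transmission G u : ℝ) + 2 * (2 * G.edgeFinset.card) + (n + n) * 2 := by
    exact_mod_cast hsum
  rw [← Nat.cast_lt (α := ℝ)]
  push_cast [htn]
  push_cast at hray
  set m : ℝ := (G.edgeFinset.card : ℝ)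
  have h1 : (n : ℝ) * ρ ≤ n * (m - (n : ℝ) ^ 2 + ((t : ℝ) + 6) * n - ((t : ℝ) ^ 2 + 4)) :=
    mul_le_mul_of_nonneg_left hle hn0.le
  have h2 : 0 < (t : ℝ) * (n - t) := mul_pos ht0 (sub_pos.mpr hlt)
  have h3 : (n * (n - t) + (t : ℝ) ^ 2) * (n + 4) < m * (n + 4) := by linarith
  exact lt_of_mul_lt_mul_right h3 (by positivity)
end

section
/- Let G be a connected graph on n ≥ 5 vertices with m edges and minimum degree δ(G) ≥ 3. If m ≥ C(n−2, 2) + 6, then G is Hamilton-connected unless G is isomorphic to one of the following graphs: K₃ ∨ (K_{n−5} + 2K₁), K₆ ∨ 6K₁, K₄ ∨ (K₂ + 3K₁), K₅ ∨ 5K₁, K₄ ∨ (K_{1,4} + K₁), K₄ ∨ (K_{1,3} + K₂), K₃ ∨ K_{2,5}, K₄ ∨ 4K₁, K₃ ∨ (K₁ + K_{1,3}), K₃ ∨ (K_{1,2} + K₂), K₂ ∨ K_{2,4}. -/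
open SimpleGraph Finset

section HamiltonList

variable {V : Type*}

/-- `l` lists the vertices of a Hamilton path of `G` from `s` to `t`. -/
structure IsHamiltonList (G : SimpleGraph V) (s t : V) (l : List V) : Prop where
  isChain : l.IsChain G.Adj
  nodup : l.Nodup
  mem : ∀ v, v ∈ l
  head? : l.head? = some s
  getLast? : l.getLast? = some t

theorem IsHamiltonList.exists_walk [DecidableEq V] {G : SimpleGraph V} {s t : V} {l : List V}
    (h : IsHamiltonList G s t l) : ∃ p : G.Walk s t, p.IsHamiltonian := by
  have hne : l ≠ [] := by
    rintro rfl
    simpa using h.mem s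
  have hs : l.head hne = s := by
    have := h.head?
    rwa [List.head?_eq_some_head hne, Option.some_inj] at this
  have ht : l.getLast hne = t := by
    have := h.getLast?
    rwa [List.getLast?_eq_some_getLast hne, Option.some_inj] at this
  refine ⟨(Walk.ofSupport l hne h.isChain).copy hs ht, fun a => ?_⟩
  rw [Walk.support_copy, Walk.support_ofSupport]
  exact List.count_eq_one_of_mem h.nodup (h.mem a)

theorem SimpleGraph.Walk.IsHamiltonian.isHamiltonList [DecidableEq V] {G : SimpleGraph V}
    {s t : V} {p : G.Walk s t} (h : p.IsHamiltonian) : IsHamiltonList G s t p.support where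
  isChain := p.isChain_adj_support
  nodup := h.isPath.support_nodup
  mem := h.mem_support
  head? := by rw [List.head?_eq_some_head p.support_ne_nil, p.head_support]
  getLast? := by rw [List.getLast?_eq_some_getLast p.support_ne_nil, p.getLast_support]

theorem List.exists_eq_append_of_not_isChain {R : V → V → Prop} :
    ∀ {l : List V}, ¬ l.IsChain R → ∃ a x y b, l = a ++ x :: y :: b ∧ ¬ R x y
  | [], h => absurd .nil h
  | [x], h => absurd (.singleton x) h
  | x :: y :: l, h => by
    by_cases hxy : R x y
    · have h' : ¬ (y :: l).IsChain R := fun h' => h (List.isChain_cons_cons.2 ⟨hxy, h'⟩)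
      obtain ⟨a, z, w, b, hl, hzw⟩ := List.exists_eq_append_of_not_isChain h'
      exact ⟨x :: a, z, w, b, by rw [hl]; rfl, hzw⟩
    · exact ⟨[], x, y, l, rfl, hxy⟩

theorem List.countP_cons_add_countP_le {p q : V → Bool} :
    ∀ {x : V} {l : List V}, (x :: l).IsChain (fun x y => ¬ (p x ∧ q y)) →
      (x :: l).countP p + l.countP q ≤
        l.length + if p ((x :: l).getLast (List.cons_ne_nil x l)) then 1 else 0
  | x, [], _ => by cases hx : p x <;> simp [hx]
  | x, y :: l, h => by
    rw [List.isChain_cons_cons] at h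
    have ih := List.countP_cons_add_countP_le h.2
    rw [List.getLast_cons (List.cons_ne_nil y l), List.countP_cons (a := x),
      List.countP_cons (a := y) (p := q), List.length_cons]
    have := h.1
    split_ifs at * <;> first | omega | (exfalso; simp_all)

theorem List.countP_add_countP_le_of_getLast {p q : V → Bool} {l : List V} {u : V}
    (h : l.IsChain (fun x y => ¬ (p x ∧ q y))) (hu : l.getLast? = some u) (hpu : p u = false) :
    l.countP p + l.countP q ≤ l.length := by
  cases l with
  | nil => simp
  | cons x l =>
    have := List.countP_cons_add_countP_le h
    rw [List.getLast?_eq_some_getLast (List.cons_ne_nil x l), Option.some_inj] at hu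
    rw [hu, hpu] at this
    rw [List.countP_cons (a := x) (p := q), List.length_cons]
    split_ifs <;> simp at this <;> omega

theorem List.countP_add_countP_le_of_head {p q : V → Bool} {l : List V} {v : V}
    (h : l.IsChain (fun x y => ¬ (p x ∧ q y))) (hv : l.head? = some v) (hqv : q v = false) :
    l.countP p + l.countP q ≤ l.length := by
  cases l with
  | nil => simp
  | cons x l =>
    have := List.countP_cons_add_countP_le h
    obtain rfl : x = v := by simpa using hv
    rw [List.countP_cons (a := x) (p := q), List.length_cons, hqv]
    split_ifs at this <;> simp <;> omega

theorem SimpleGraph.degree_eq_countP [Fintype V] [DecidableEq V] (G : SimpleGraph V)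
    [DecidableRel G.Adj] {l : List V} (hl : l.Nodup) (hmem : ∀ v, v ∈ l) (u : V) :
    G.degree u = l.countP (fun x => decide (G.Adj u x)) := by
  have : G.neighborFinset u = (l.filter (fun x => decide (G.Adj u x))).toFinset := by
    ext x
    simp [hmem]
  rw [← G.card_neighborFinset_eq_degree, this, List.toFinset_card_of_nodup (hl.filter _),
    List.countP_eq_length_filter]

theorem IsHamiltonList.of_crossing_left {G : SimpleGraph V} {s t u v x y : V} {a b Q : List V}
    (h₁ : (a ++ x :: y :: b).IsChain G.Adj) (h₂ : Q.IsChain G.Adj)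
    (hu : (a ++ x :: y :: b).getLast? = some u) (hv : Q.head? = some v)
    (hnd : ((a ++ x :: y :: b) ++ Q).Nodup) (hmem : ∀ w, w ∈ (a ++ x :: y :: b) ++ Q)
    (hs : ((a ++ x :: y :: b) ++ Q).head? = some s)
    (ht : ((a ++ x :: y :: b) ++ Q).getLast? = some t)
    (hux : G.Adj u x) (hvy : G.Adj v y) :
    IsHamiltonList G s t ((a ++ [x]) ++ (y :: b).reverse ++ Q) := by
  have hp : ((a ++ [x]) ++ (y :: b).reverse ++ Q).Perm ((a ++ x :: y :: b) ++ Q) := by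
    rw [show a ++ x :: y :: b = (a ++ [x]) ++ (y :: b) by simp]
    exact ((List.Perm.refl _).append (List.reverse_perm _)).append (List.Perm.refl _)
  have hyb : (y :: b).getLast? = some u := by
    rw [← hu]; simp [List.getLast?_append, List.getLast?_cons]
  refine ⟨?_, hp.nodup_iff.2 hnd, fun w => hp.mem_iff.2 (hmem w), ?_, ?_⟩
  · rw [show a ++ x :: y :: b = (a ++ [x]) ++ (y :: b) by simp] at h₁
    rw [List.isChain_append] at h₁
    rw [List.isChain_append, List.isChain_append, List.isChain_reverse]
    refine ⟨⟨h₁.1, ?_, ?_⟩, h₂, ?_⟩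
    · exact h₁.2.1.imp fun _ _ h => h.symm
    · intro z hz w hw
      simp at hz
      rw [List.head?_reverse, hyb] at hw
      simp at hw
      subst hz hw
      exact hux.symm
    · intro z hz w hw
      rw [hv] at hw
      rw [List.getLast?_append, List.getLast?_reverse] at hz
      simp at hz hw
      subst hz hw
      exact hvy.symm
  · rw [← hs]
    cases a <;> simp
  · rw [← ht]
    have : Q.getLast? ≠ none := by
      intro h; simp at h; simp [h] at hv
    obtain ⟨z, hz⟩ := Option.ne_none_iff_exists'.1 this
    rw [List.getLast?_append, List.getLast?_append (l := a ++ x :: y :: b), hz]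
    rfl

theorem IsHamiltonList.of_crossing_right {G : SimpleGraph V} {s t u v x y : V} {a b P : List V}
    (h₁ : P.IsChain G.Adj) (h₂ : (a ++ x :: y :: b).IsChain G.Adj)
    (hu : P.getLast? = some u) (hv : (a ++ x :: y :: b).head? = some v)
    (hnd : (P ++ (a ++ x :: y :: b)).Nodup) (hmem : ∀ w, w ∈ P ++ (a ++ x :: y :: b))
    (hs : (P ++ (a ++ x :: y :: b)).head? = some s)
    (ht : (P ++ (a ++ x :: y :: b)).getLast? = some t)
    (hux : G.Adj u x) (hvy : G.Adj v y) :
    IsHamiltonList G s t (P ++ ((a ++ [x]).reverse ++ (y :: b))) := by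
  have hp : (P ++ ((a ++ [x]).reverse ++ (y :: b))).Perm (P ++ (a ++ x :: y :: b)) := by
    rw [show a ++ x :: y :: b = (a ++ [x]) ++ (y :: b) by simp]
    exact (List.Perm.refl _).append ((List.reverse_perm _).append (List.Perm.refl _))
  have hax : (a ++ [x]).head? = some v := by
    rw [← hv]; cases a <;> simp
  refine ⟨?_, hp.nodup_iff.2 hnd, fun w => hp.mem_iff.2 (hmem w), ?_, ?_⟩
  · rw [show a ++ x :: y :: b = (a ++ [x]) ++ (y :: b) by simp] at h₂
    rw [List.isChain_append] at h₂
    rw [List.isChain_append, List.isChain_append, List.isChain_reverse]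
    refine ⟨h₁, ⟨?_, h₂.2.1, ?_⟩, ?_⟩
    · exact h₂.1.imp fun _ _ h => h.symm
    · intro z hz w hw
      rw [List.getLast?_reverse, hax] at hz
      simp at hz hw
      subst hz hw
      exact hvy
    · intro z hz w hw
      rw [hu] at hz
      simp at hz hw
      subst hz hw
      exact hux
  · rw [← hs]
    have : P.head? ≠ none := by
      intro h; simp at h; simp [h] at hu
    obtain ⟨z, hz⟩ := Option.ne_none_iff_exists'.1 this
    simp [hz]
  · rw [← ht]
    simp [List.getLast?_append, List.getLast?_cons]

theorem exists_isHamiltonList_of_card_lt_degree_add_degree [Fintype V] [DecidableEq V]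
    {G : SimpleGraph V} [DecidableRel G.Adj] {s t u v : V} {P Q : List V}
    (hP : P.IsChain G.Adj) (hQ : Q.IsChain G.Adj)
    (hu : P.getLast? = some u) (hv : Q.head? = some v)
    (hnd : (P ++ Q).Nodup) (hmem : ∀ w, w ∈ P ++ Q)
    (hs : (P ++ Q).head? = some s) (ht : (P ++ Q).getLast? = some t)
    (hdeg : Fintype.card V < G.degree u + G.degree v) :
    ∃ l, IsHamiltonList G s t l := by
  by_contra hno
  have hP' : P.IsChain (fun x y => ¬ (decide (G.Adj u x) ∧ decide (G.Adj v y))) := by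
    by_contra h
    obtain ⟨a, x, y, b, rfl, hxy⟩ := List.exists_eq_append_of_not_isChain h
    simp only [decide_eq_true_eq, not_not] at hxy
    exact hno ⟨_, IsHamiltonList.of_crossing_left hP hQ hu hv hnd hmem hs ht hxy.1 hxy.2⟩
  have hQ' : Q.IsChain (fun x y => ¬ (decide (G.Adj u x) ∧ decide (G.Adj v y))) := by
    by_contra h
    obtain ⟨a, x, y, b, rfl, hxy⟩ := List.exists_eq_append_of_not_isChain h
    simp only [decide_eq_true_eq, not_not] at hxy
    exact hno ⟨_, IsHamiltonList.of_crossing_right hP hQ hu hv hnd hmem hs ht hxy.1 hxy.2⟩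
  have h₁ := List.countP_add_countP_le_of_getLast hP' hu (by simp)
  have h₂ := List.countP_add_countP_le_of_head hQ' hv (by simp)
  have hlen : P.length + Q.length = Fintype.card V := by
    rw [← List.length_append, ← List.toFinset_card_of_nodup hnd, ← Finset.card_univ]
    congr 1
    ext w
    simpa using hmem w
  rw [G.degree_eq_countP hnd hmem u, G.degree_eq_countP hnd hmem v, List.countP_append,
    List.countP_append] at hdeg
  omega

/-- The Bondy–Chvátal closure step for Hamilton-connectedness. -/
theorem IsHamiltonianConnected.of_sup_edge [Fintype V] [DecidableEq V]
    {G : SimpleGraph V} [DecidableRel G.Adj] {u v : V}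
    (hdeg : Fintype.card V < G.degree u + G.degree v)
    (h : IsHamiltonianConnected (G ⊔ SimpleGraph.edge u v)) : IsHamiltonianConnected G := by
  intro s t hst
  obtain ⟨p, hp⟩ := h s t hst
  have hl := hp.isHamiltonList
  generalize p.support = l at hl
  suffices ∃ l, IsHamiltonList G s t l from this.elim fun _ h => h.exists_walk
  by_cases hc : l.IsChain G.Adj
  · exact ⟨l, hc, hl.nodup, hl.mem, hl.head?, hl.getLast?⟩
  obtain ⟨a, x, y, b, rfl, hxy⟩ := List.exists_eq_append_of_not_isChain hc
  have hab : a ++ x :: y :: b = (a ++ [x]) ++ (y :: b) := by simp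
  rw [hab] at hl
  have hch := List.isChain_append.1 hl.isChain
  have hnd := List.nodup_append.1 hl.nodup
  have hadj : (G ⊔ SimpleGraph.edge u v).Adj x y := hch.2.2 x (by simp) y (by simp)
  have hxy' : (x = u ∧ y = v) ∨ (x = v ∧ y = u) := by
    simp only [SimpleGraph.sup_adj, SimpleGraph.edge_adj] at hadj
    tauto
  have aux {l : List V} {z : V} (hzuv : z = u ∨ z = v)
      (hl : l.IsChain (G ⊔ SimpleGraph.edge u v).Adj) (hz : z ∉ l) : l.IsChain G.Adj := by
    refine List.IsChain.imp_of_mem_imp (fun c d hc hd hcd => ?_) hl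
    simp only [SimpleGraph.sup_adj, SimpleGraph.edge_adj] at hcd
    grind
  have hP : (a ++ [x]).IsChain G.Adj := aux (z := y) (by tauto) hch.1
    fun h => hnd.2.2 y h y (by simp) rfl
  have hQ : (y :: b).IsChain G.Adj := aux (z := x) (by tauto) hch.2.1
    fun h => hnd.2.2 x (by simp) x h rfl
  refine exists_isHamiltonList_of_card_lt_degree_add_degree hP hQ (u := x) (v := y) (by simp)
    (by simp) hl.nodup hl.mem hl.head? hl.getLast? ?_
  rcases hxy' with ⟨rfl, rfl⟩ | ⟨rfl, rfl⟩ <;> omega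

theorem isHamiltonianConnected_top [Fintype V] [DecidableEq V] :
    IsHamiltonianConnected (⊤ : SimpleGraph V) := by
  intro s t hst
  have key : IsHamiltonList (⊤ : SimpleGraph V) s t
      (s :: ((Finset.univ.erase s).erase t).toList ++ [t]) := by
    have hnd : (s :: ((Finset.univ.erase s).erase t).toList ++ [t]).Nodup := by
      rw [List.nodup_append]
      simp [Finset.nodup_toList, hst]
      tauto
    refine ⟨?_, hnd, fun v => ?_, by simp, List.getLast?_concat⟩
    · exact List.Pairwise.isChain hnd
    · by_cases v = s <;> by_cases v = t <;> simp [*]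
  exact key.exists_walk

end HamiltonList

section ClosedGraph

variable {V : Type*} [Fintype V] [DecidableEq V]

/-- In a graph where nonadjacent vertices have degree sum at most the order, there are a set `A` of
`k - 1` vertices of degree at most `k` and a set `L ⊇ A` of `n - k` vertices of degree at most
`n - k`. -/
theorem exists_subset_card_degree_le {G : SimpleGraph V} [DecidableRel G.Adj]
    (hG : ∀ u v, u ≠ v → ¬ G.Adj u v → G.degree u + G.degree v ≤ Fintype.card V)
    (hne : G ≠ ⊤) (hδ : ∀ v, 3 ≤ G.degree v) :
    ∃ k, 3 ≤ k ∧ 2 * k ≤ Fintype.card V ∧ ∃ A L : Finset V, A ⊆ L ∧ #A = k - 1 ∧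
      #L = Fintype.card V - k ∧ (∀ x ∈ A, G.degree x ≤ k) ∧
      ∀ x ∈ L, G.degree x ≤ Fintype.card V - k := by
  obtain ⟨u, v, huv, hadj, hmax, hle⟩ : ∃ u v, u ≠ v ∧ ¬ G.Adj u v ∧
      (∀ a b, a ≠ b → ¬ G.Adj a b → G.degree a + G.degree b ≤ G.degree u + G.degree v) ∧
      G.degree u ≤ G.degree v := by
    let S : Finset (V × V) := {p | p.1 ≠ p.2 ∧ ¬ G.Adj p.1 p.2}
    have hS : S.Nonempty := by
      by_contra h
      refine hne (top_le_iff.1 fun a b hab => ?_)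
      by_contra hab'
      exact h ⟨(a, b), by simp [S, hab']; exact hab⟩
    obtain ⟨⟨u, v⟩, huv, hmax⟩ := S.exists_max_image (fun p => G.degree p.1 + G.degree p.2) hS
    simp only [S, Finset.mem_filter, Finset.mem_univ, true_and, Prod.forall] at huv hmax
    rcases le_total (G.degree u) (G.degree v) with h | h
    · exact ⟨u, v, huv.1, huv.2, fun a b hab hab' => hmax a b ⟨hab, hab'⟩, h⟩
    · refine ⟨v, u, huv.1.symm, fun h => huv.2 h.symm, fun a b hab hab' => ?_, h⟩
      have := hmax a b ⟨hab, hab'⟩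
      omega
  have hsum := hG u v huv hadj
  have hk := hδ u
  have hcard (w : V) : #(G.neighborFinset w)ᶜ = Fintype.card V - G.degree w := by
    rw [Finset.card_compl, G.card_neighborFinset_eq_degree]
  obtain ⟨A, hA, hAcard⟩ := Finset.exists_subset_card_eq
    (s := (G.neighborFinset v)ᶜ.erase v) (n := G.degree u - 1) (by
      rw [Finset.card_erase_of_mem (by simp), hcard]
      omega)
  have hAdeg : ∀ x ∈ A, G.degree x ≤ G.degree u := by
    intro x hx
    have hx' := hA hx
    simp only [Finset.mem_erase, Finset.mem_compl, SimpleGraph.mem_neighborFinset] at hx'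
    have := hmax x v hx'.1 fun h => hx'.2 h.symm
    omega
  let L : Finset V := {x | G.degree x ≤ Fintype.card V - G.degree u}
  have hAL : A ⊆ L := fun x hx => by
    have := hAdeg x hx
    simp only [L, Finset.mem_filter, Finset.mem_univ, true_and]
    omega
  have hLcard : Fintype.card V - G.degree u ≤ #L := by
    rw [← hcard]
    refine Finset.card_le_card fun x hx => ?_
    simp only [L, Finset.mem_filter, Finset.mem_univ, true_and]
    by_cases hxu : x = u
    · subst hxu; omega
    · simp only [Finset.mem_compl, SimpleGraph.mem_neighborFinset] at hx
      have := hmax u x (Ne.symm hxu) hx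
      omega
  obtain ⟨L', hAL', hL'L, hL'⟩ := Finset.exists_subsuperset_card_eq hAL
    (n := Fintype.card V - G.degree u) (by omega) hLcard
  refine ⟨G.degree u, hk, by omega, A, L', hAL', hAcard, hL', hAdeg, fun x hx => ?_⟩
  simpa [L] using hL'L hx

/-- The degrees of the graph `K_k ∨ (K_{n-2k+1} + (k-1)K₁)`, by colour class. -/
def extremalDegree (n k : ℕ) (i : Fin 3) : ℕ :=
  if i = 0 then n - 1 else if i = 1 then k else n - k

/-- The adjacency of the graph `K_k ∨ (K_{n-2k+1} + (k-1)K₁)`, by colour class. -/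
def ExtremalAdj (i j : Fin 3) : Prop :=
  i = 0 ∨ j = 0 ∨ i = 2 ∧ j = 2

theorem adj_iff_extremalAdj {G : SimpleGraph V} [DecidableRel G.Adj] {k : ℕ} (hk : 1 ≤ k)
    (hkn : 2 * k ≤ Fintype.card V) {c : V → Fin 3} (h₀ : #{x | c x = 0} = k)
    (h₁ : #{x | c x = 1} = k - 1)
    (hdeg : ∀ x, G.degree x = extremalDegree (Fintype.card V) k (c x)) (x y : V) :
    G.Adj x y ↔ x ≠ y ∧ ExtremalAdj (c x) (c y) := by
  have huniv {x : V} (hx : c x = 0) (y : V) (hxy : x ≠ y) : G.Adj x y := by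
    have hd := hdeg x
    simp only [extremalDegree, hx, if_true] at hd
    have : G.neighborFinset x = Finset.univ.erase x := by
      refine Finset.eq_of_subset_of_card_le (fun z hz => ?_) ?_
      · simp only [SimpleGraph.mem_neighborFinset] at hz
        simp [hz.ne']
      · rw [G.card_neighborFinset_eq_degree, hd, Finset.card_erase_of_mem (by simp),
          Finset.card_univ]
    rw [← SimpleGraph.mem_neighborFinset, this]
    simp [hxy.symm]
  have hone {x : V} (hx : c x = 1) (y : V) : G.Adj x y ↔ c y = 0 := by
    have hd := hdeg x
    simp only [extremalDegree, hx, one_ne_zero, if_true, if_false] at hd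
    have : ({y | c y = 0} : Finset V) = G.neighborFinset x := by
      refine Finset.eq_of_subset_of_card_le (fun z hz => ?_) ?_
      · simp only [Finset.mem_filter, Finset.mem_univ, true_and] at hz
        rw [SimpleGraph.mem_neighborFinset]
        refine (huniv hz x ?_).symm
        rintro rfl
        simp [hz] at hx
      · rw [G.card_neighborFinset_eq_degree, hd, h₀]
    rw [← SimpleGraph.mem_neighborFinset, ← this]
    simp
  have htwo {x : V} (hx : c x = 2) (y : V) (hxy : x ≠ y) (hy : c y ≠ 1) : G.Adj x y := by
    have hd := hdeg x
    simp [extremalDegree, hx] at hd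
    have : G.neighborFinset x = ({y | c y = 1} : Finset V)ᶜ.erase x := by
      refine Finset.eq_of_subset_of_card_le (fun z hz => ?_) ?_
      · simp only [SimpleGraph.mem_neighborFinset] at hz
        simp only [Finset.mem_erase, Finset.mem_compl, Finset.mem_filter, Finset.mem_univ,
          true_and]
        refine ⟨hz.ne', fun hz1 => ?_⟩
        have := (hone hz1 x).1 hz.symm
        simp [hx] at this
      · rw [G.card_neighborFinset_eq_degree, hd, Finset.card_erase_of_mem (by simp [hx]),
          Finset.card_compl, h₁]
        omega
    rw [← SimpleGraph.mem_neighborFinset, this]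
    simp [hxy.symm, hy]
  by_cases hxy : x = y
  · simp [hxy]
  simp only [ne_eq, hxy, not_false_eq_true, true_and, ExtremalAdj]
  have hcx : c x = 0 ∨ c x = 1 ∨ c x = 2 := by generalize c x = i; decide +revert
  have hcy : c y = 0 ∨ c y = 1 ∨ c y = 2 := by generalize c y = i; decide +revert
  rcases hcx with hx | hx | hx
  · simp [hx, huniv hx y hxy]
  · simp [hx, hone hx y]
  · rcases hcy with hy | hy | hy
    · simp [hy, (huniv hy x (Ne.symm hxy)).symm]
    · simp [hx, hy, G.adj_comm x y, hone hy x]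
    · simp [hx, hy, htwo hx y hxy]

theorem extremal_parameters_of_le {n i j D : ℕ} (hn : n = 2 * (i + 3) + j)
    (h : (n - 2) * (n - 3) + 12 + D ≤
      (i + 3) * (n - 1) + (i + 3 - 1) * (i + 3) + (n - 2 * (i + 3) + 1) * (n - (i + 3))) :
    (i = 0 ∧ D = 0) ∨ (i = 1 ∧ j = 0 ∧ D ≤ 2) ∨ (i = 1 ∧ j = 1 ∧ D = 0) ∨
      (i = 2 ∧ j = 0 ∧ D ≤ 2) ∨ (i = 3 ∧ j = 0 ∧ D = 0) := by
  have hle : i * i + 2 * i * j + D ≤ 3 * i := by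
    have e1 : n - 1 = 2 * i + j + 5 := by omega
    have e2 : n - 2 = 2 * i + j + 4 := by omega
    have e3 : n - 3 = 2 * i + j + 3 := by omega
    have e4 : n - 2 * (i + 3) + 1 = j + 1 := by omega
    have e5 : n - (i + 3) = i + j + 3 := by omega
    have e6 : i + 3 - 1 = i + 2 := by omega
    rw [e1, e2, e3, e4, e5, e6] at h
    nlinarith
  have hi : i ≤ 3 := by
    by_contra! hi
    have h4 : 4 * i ≤ i * i := Nat.mul_le_mul_right i hi
    have hij : 0 ≤ 2 * i * j := Nat.zero_le _
    linarith
  interval_cases i <;> omega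

theorem exists_coloring_of_degree_sum_le {G : SimpleGraph V} [DecidableRel G.Adj]
    (hG : ∀ u v, u ≠ v → ¬ G.Adj u v → G.degree u + G.degree v ≤ Fintype.card V)
    (hne : G ≠ ⊤) (hδ : ∀ v, 3 ≤ G.degree v)
    (hm : (Fintype.card V - 2) * (Fintype.card V - 3) + 12 ≤ 2 * #G.edgeFinset) :
    ∃ k, 3 ≤ k ∧ 2 * k ≤ Fintype.card V ∧
      (k = 3 ∨ Fintype.card V = 8 ∧ k = 4 ∨ Fintype.card V = 9 ∧ k = 4 ∨
        Fintype.card V = 10 ∧ k = 5 ∨ Fintype.card V = 12 ∧ k = 6) ∧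
      2 * #G.edgeFinset = k * (Fintype.card V - 1) + (k - 1) * k +
        (Fintype.card V - 2 * k + 1) * (Fintype.card V - k) ∧
      ∃ c : V → Fin 3, #{x | c x = 0} = k ∧ #{x | c x = 1} = k - 1 ∧
        #{x | c x = 2} = Fintype.card V - 2 * k + 1 ∧
        ∀ x y, G.Adj x y ↔ x ≠ y ∧ ExtremalAdj (c x) (c y) := by
  obtain ⟨k, hk, hkn, A, L, hAL, hA, hL, hAdeg, hLdeg⟩ := exists_subset_card_degree_le hG hne hδ
  let c : V → Fin 3 := fun x => if x ∈ A then 1 else if x ∈ L then 2 else 0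
  have h₀ : #{x | c x = 0} = k := by
    have : ({x | c x = 0} : Finset V) = Lᶜ := by
      ext x
      have := @hAL x
      by_cases x ∈ A <;> by_cases x ∈ L <;> simp_all [c]
    rw [this, Finset.card_compl, hL]
    omega
  have h₁ : #{x | c x = 1} = k - 1 := by
    have : ({x | c x = 1} : Finset V) = A := by
      ext x
      by_cases x ∈ A <;> by_cases x ∈ L <;> simp_all [c]
    rw [this, hA]
  have h₂ : #{x | c x = 2} = Fintype.card V - 2 * k + 1 := by
    have : ({x | c x = 2} : Finset V) = L \ A := by
      ext x
      by_cases x ∈ A <;> by_cases x ∈ L <;> simp_all [c]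
    rw [this, Finset.card_sdiff_of_subset hAL, hL, hA]
    omega
  have hle (x : V) : G.degree x ≤ extremalDegree (Fintype.card V) k (c x) := by
    by_cases hxA : x ∈ A
    · simpa [c, hxA, extremalDegree] using hAdeg x hxA
    by_cases hxL : x ∈ L
    · simpa [c, hxA, hxL, extremalDegree] using hLdeg x hxL
    · have := G.degree_lt_card_verts x
      simp [c, hxA, hxL, extremalDegree]
      omega
  clear_value c
  set n := Fintype.card V with hn
  have hsum : ∑ x, extremalDegree n k (c x) =
      k * (n - 1) + (k - 1) * k + (n - 2 * k + 1) * (n - k) := by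
    rw [← Finset.sum_fiberwise' Finset.univ c (extremalDegree n k), Fin.sum_univ_three]
    simp [h₀, h₁, h₂, extremalDegree]
  set D := ∑ x, (extremalDegree n k (c x) - G.degree x) with hD
  have hDsum : 2 * #G.edgeFinset + D =
      k * (n - 1) + (k - 1) * k + (n - 2 * k + 1) * (n - k) := by
    rw [← hsum, ← G.sum_degrees_eq_twice_card_edges, hD, ← Finset.sum_add_distrib]
    exact Finset.sum_congr rfl fun x _ => by have := hle x; omega
  have hD0 : D = 0 → ∀ x, G.degree x = extremalDegree n k (c x) := by
    intro h x
    have := Finset.sum_eq_zero_iff.1 h x (Finset.mem_univ x)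
    have := hle x
    omega
  obtain ⟨i, rfl⟩ := Nat.exists_eq_add_of_le' hk
  obtain ⟨j, hj⟩ := Nat.exists_eq_add_of_le hkn
  have hshape := extremal_parameters_of_le hj (hDsum ▸ Nat.add_le_add_right hm D)
  have hDzero : D = 0 := by
    by_contra hDne
    obtain ⟨hi1, hj0, hD2⟩ : 1 ≤ i ∧ j = 0 ∧ D ≤ 2 := by omega
    have huniv (x : V) (hx : c x = 0) (y : V) (hxy : y ≠ x) : G.Adj x y := by
      by_contra hadj
      have h₁ := hG x y hxy.symm hadj
      have h₂ : (extremalDegree n (i + 3) (c x) - G.degree x) +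
          (extremalDegree n (i + 3) (c y) - G.degree y) ≤ D := by
        rw [hD, ← Finset.sum_pair hxy.symm
          (f := fun z => extremalDegree n (i + 3) (c z) - G.degree z)]
        exact Finset.sum_le_sum_of_subset (Finset.subset_univ _)
      have h₃ : extremalDegree n (i + 3) (c x) = n - 1 := by simp [extremalDegree, hx]
      have h₄ : i + 3 ≤ extremalDegree n (i + 3) (c y) := by
        unfold extremalDegree
        split_ifs <;> omega
      omega
    refine hDne (Finset.sum_eq_zero fun x _ => ?_)
    by_cases hx : c x = 0
    · have : Finset.univ.erase x ⊆ G.neighborFinset x := fun y hy => by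
        rw [SimpleGraph.mem_neighborFinset]
        exact huniv x hx y (Finset.ne_of_mem_erase hy)
      have := Finset.card_le_card this
      rw [G.card_neighborFinset_eq_degree, Finset.card_erase_of_mem (by simp),
        Finset.card_univ] at this
      simp [extremalDegree, hx]
      omega
    · have : ({y | c y = 0} : Finset V) ⊆ G.neighborFinset x := fun y hy => by
        simp only [Finset.mem_filter, Finset.mem_univ, true_and] at hy
        rw [SimpleGraph.mem_neighborFinset]
        refine (huniv y hy x ?_).symm
        rintro rfl
        exact hx hy
      have := Finset.card_le_card this
      rw [G.card_neighborFinset_eq_degree, h₀] at this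
      unfold extremalDegree
      split_ifs <;> omega
  refine ⟨i + 3, hk, hkn, by omega, by omega, c, h₀, h₁, h₂, ?_⟩
  exact adj_iff_extremalAdj (by omega) hkn h₀ h₁ (hD0 hDzero)

end ClosedGraph

section Isomorphisms

theorem joinGraph_adj_inl_inl {α β : Type*} {G : SimpleGraph α} {H : SimpleGraph β} {a b : α} :
    (joinGraph G H).Adj (Sum.inl a) (Sum.inl b) ↔ G.Adj a b := by
  simp only [joinGraph, SimpleGraph.fromRel_adj, G.adj_comm b a, or_self, ne_eq, Sum.inl.injEq]
  exact ⟨fun h => h.2, fun h => ⟨h.ne, h⟩⟩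

theorem joinGraph_adj_inr_inr {α β : Type*} {G : SimpleGraph α} {H : SimpleGraph β} {a b : β} :
    (joinGraph G H).Adj (Sum.inr a) (Sum.inr b) ↔ H.Adj a b := by
  simp only [joinGraph, SimpleGraph.fromRel_adj, H.adj_comm b a, or_self, ne_eq, Sum.inr.injEq]
  exact ⟨fun h => h.2, fun h => ⟨h.ne, h⟩⟩

theorem joinGraph_adj_inl_inr {α β : Type*} {G : SimpleGraph α} {H : SimpleGraph β} {a : α}
    {b : β} : (joinGraph G H).Adj (Sum.inl a) (Sum.inr b) := by
  simp [joinGraph]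

theorem joinGraph_adj_inr_inl {α β : Type*} {G : SimpleGraph α} {H : SimpleGraph β} {a : α}
    {b : β} : (joinGraph G H).Adj (Sum.inr b) (Sum.inl a) :=
  joinGraph_adj_inl_inr.symm

theorem card_filter_sumElim {α β ι : Type*} [Fintype α] [Fintype β] [DecidableEq ι] (f : α → ι)
    (g : β → ι) (i : ι) :
    #{x : α ⊕ β | Sum.elim f g x = i} = #{x | f x = i} + #{x | g x = i} := by
  simp only [Finset.card_filter, Fintype.sum_sum_type, Sum.elim_inl, Sum.elim_inr]
  rfl

theorem nonempty_iso_of_coloring {V W ι : Type*} [Fintype V] [Fintype W] [DecidableEq ι]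
    {G : SimpleGraph V} {H : SimpleGraph W} {c : V → ι} {d : W → ι} (R : ι → ι → Prop)
    (hG : ∀ x y, G.Adj x y ↔ x ≠ y ∧ R (c x) (c y))
    (hH : ∀ x y, H.Adj x y ↔ x ≠ y ∧ R (d x) (d y))
    (hcard : ∀ i, #{x | c x = i} = #{y | d y = i}) : Nonempty (G ≃g H) := by
  have hfib (i : ι) : Nonempty ({x // c x = i} ≃ {y // d y = i}) := by
    refine ⟨Fintype.equivOfCardEq ?_⟩
    rw [Fintype.card_subtype, Fintype.card_subtype, hcard]
  let e : V ≃ W := Equiv.ofFiberEquiv fun i => (hfib i).some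
  have he (x : V) : d (e x) = c x := Equiv.ofFiberEquiv_map _ x
  refine ⟨⟨e, fun {x y} => ?_⟩⟩
  rw [hG, hH, he, he, e.injective.ne_iff]

theorem nonempty_iso_join_sum_top_bot {V : Type*} [Fintype V] {G : SimpleGraph V}
    {k m l : ℕ} {c : V → Fin 3} (h₀ : #{x | c x = 0} = k) (h₁ : #{x | c x = 1} = l)
    (h₂ : #{x | c x = 2} = m) (hG : ∀ x y, G.Adj x y ↔ x ≠ y ∧ ExtremalAdj (c x) (c y)) :
    Nonempty (G ≃g joinGraph (⊤ : SimpleGraph (Fin k))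
      ((⊤ : SimpleGraph (Fin m)) ⊕g (⊥ : SimpleGraph (Fin l)))) := by
  refine nonempty_iso_of_coloring ExtremalAdj hG
    (d := Sum.elim (fun _ => 0) (Sum.elim (fun _ => 2) (fun _ => 1))) ?_ ?_
  · rintro (x | x | x) (y | y | y) <;>
      simp [joinGraph_adj_inl_inl, joinGraph_adj_inr_inr, joinGraph_adj_inl_inr,
        joinGraph_adj_inr_inl, ExtremalAdj]
  · intro i
    fin_cases i <;> simp [h₀, h₁, h₂, card_filter_sumElim]

variable {V : Type*} [Fintype V] [DecidableEq V] {G : SimpleGraph V}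

theorem nonempty_iso_join_bot {k l : ℕ} {S : Finset V} (hS : #S = k) (hS' : #Sᶜ = l)
    (hG : ∀ x y, G.Adj x y ↔ x ≠ y ∧ (x ∈ S ∨ y ∈ S)) :
    Nonempty (G ≃g joinGraph (⊤ : SimpleGraph (Fin k)) (⊥ : SimpleGraph (Fin l))) := by
  refine nonempty_iso_of_coloring (fun p q : Prop => p ∨ q) (c := fun x => x ∈ S) hG
    (d := Sum.elim (fun _ => True) (fun _ => False)) ?_ ?_
  · rintro (x | x) (y | y) <;>
      simp [joinGraph_adj_inl_inl, joinGraph_adj_inr_inr, joinGraph_adj_inl_inr,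
        joinGraph_adj_inr_inl]
  · intro i
    have hc : #{x | x ∉ S} = l := by
      rw [← hS', ← Finset.compl_filter]; simp
    by_cases hi : i <;> simp [hi, hS, hc, card_filter_sumElim]

theorem nonempty_iso_join_completeBipartite {k l : ℕ} {S : Finset V} (hS : #S = k + 2)
    (hS' : #Sᶜ = l) {a b : V} (ha : a ∈ S) (hb : b ∈ S) (hab : a ≠ b)
    (hG : ∀ x y, G.Adj x y ↔ (x ≠ y ∧ (x ∈ S ∨ y ∈ S)) ∧ s(x, y) ≠ s(a, b)) :
    Nonempty (G ≃g joinGraph (⊤ : SimpleGraph (Fin k))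
      (completeBipartiteGraph (Fin 2) (Fin l))) := by
  let c : V → Fin 3 := fun x => if x = a ∨ x = b then 1 else if x ∈ S then 0 else 2
  let R : Fin 3 → Fin 3 → Prop := fun p q => (p ≠ 2 ∨ q ≠ 2) ∧ ¬ (p = 1 ∧ q = 1)
  refine nonempty_iso_of_coloring R (c := c)
    (d := Sum.elim (fun _ => 0) (Sum.elim (fun _ => 1) (fun _ => 2))) ?_ ?_ ?_
  · intro x y
    rw [hG]
    simp only [c, R, ne_eq, Sym2.eq_iff]
    grind
  · rintro (x | x | x) (y | y | y) <;>
      simp [joinGraph_adj_inl_inl, joinGraph_adj_inr_inr, joinGraph_adj_inl_inr,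
        joinGraph_adj_inr_inl, R]
  · intro i
    have h₀ : #{x | c x = 0} = k := by
      have : ({x | c x = 0} : Finset V) = (S.erase a).erase b := by
        ext x; simp only [c, Finset.mem_filter, Finset.mem_univ, Finset.mem_erase]; grind
      rw [this, Finset.card_erase_of_mem (by simp [hb, hab.symm]), Finset.card_erase_of_mem ha, hS]
      rfl
    have h₁ : #{x | c x = 1} = 2 := by
      have : ({x | c x = 1} : Finset V) = {a, b} := by
        ext x
        simp only [c, Finset.mem_filter, Finset.mem_univ, Finset.mem_insert,
          Finset.mem_singleton]
        grind
      rw [this, Finset.card_pair hab]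
    have h₂ : #{x | c x = 2} = l := by
      have : ({x | c x = 2} : Finset V) = Sᶜ := by
        ext x; simp only [c, Finset.mem_filter, Finset.mem_univ, Finset.mem_compl]; grind
      rw [this, hS']
    fin_cases i <;> simp [h₀, h₁, h₂, card_filter_sumElim]

/-- The adjacency of `K_k ∨ (K_{1,l} + K₁)`, by colour class. -/
def StarAdj (p q : Fin 4) : Prop :=
  (p = 0 ∨ p = 1 ∨ q = 0 ∨ q = 1) ∧ ¬ (p = 1 ∧ q = 3) ∧ ¬ (p = 3 ∧ q = 1)

theorem exists_coloring_starAdj {k l : ℕ} {S : Finset V} (hS : #S = k + 1)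
    (hS' : #Sᶜ = l + 1) {a b : V} (ha : a ∈ S) (hb : b ∉ S)
    (hG : ∀ x y, G.Adj x y ↔ (x ≠ y ∧ (x ∈ S ∨ y ∈ S)) ∧ s(x, y) ≠ s(a, b)) :
    ∃ c : V → Fin 4, #{x | c x = 0} = k ∧ #{x | c x = 1} = 1 ∧ #{x | c x = 2} = l ∧
      #{x | c x = 3} = 1 ∧ ∀ x y, G.Adj x y ↔ x ≠ y ∧ StarAdj (c x) (c y) := by
  let c : V → Fin 4 := fun x => if x = a then 1 else if x = b then 3 else if x ∈ S then 0 else 2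
  refine ⟨c, ?_, ?_, ?_, ?_, ?_⟩
  · have : ({x | c x = 0} : Finset V) = S.erase a := by
      ext x; simp only [c, Finset.mem_filter, Finset.mem_univ, Finset.mem_erase]; grind
    rw [this, Finset.card_erase_of_mem ha, hS]
    rfl
  · have : ({x | c x = 1} : Finset V) = {a} := by
      ext x; simp only [c, Finset.mem_filter, Finset.mem_univ, Finset.mem_singleton]; grind
    rw [this, Finset.card_singleton]
  · have : ({x | c x = 2} : Finset V) = Sᶜ.erase b := by
      ext x
      simp only [c, Finset.mem_filter, Finset.mem_univ, Finset.mem_erase, Finset.mem_compl]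
      grind
    rw [this, Finset.card_erase_of_mem (by simpa using hb), hS']
    rfl
  · have : ({x | c x = 3} : Finset V) = {b} := by
      ext x; simp only [c, Finset.mem_filter, Finset.mem_univ, Finset.mem_singleton]; grind
    rw [this, Finset.card_singleton]
  · intro x y
    rw [hG]
    simp only [c, StarAdj, ne_eq, Sym2.eq_iff]
    grind

theorem nonempty_iso_join_star_sum_bot {k l : ℕ} {S : Finset V} (hS : #S = k + 1)
    (hS' : #Sᶜ = l + 1) {a b : V} (ha : a ∈ S) (hb : b ∉ S)
    (hG : ∀ x y, G.Adj x y ↔ (x ≠ y ∧ (x ∈ S ∨ y ∈ S)) ∧ s(x, y) ≠ s(a, b)) :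
    Nonempty (G ≃g joinGraph (⊤ : SimpleGraph (Fin k))
      (completeBipartiteGraph (Fin 1) (Fin l) ⊕g (⊥ : SimpleGraph (Fin 1)))) := by
  obtain ⟨c, h₀, h₁, h₂, h₃, hc⟩ := exists_coloring_starAdj hS hS' ha hb hG
  refine nonempty_iso_of_coloring StarAdj hc
    (d := Sum.elim (fun _ => 0) (Sum.elim (Sum.elim (fun _ => 1) (fun _ => 2)) (fun _ => 3))) ?_ ?_
  · rintro (x | (x | x) | x) (y | (y | y) | y) <;>
      simp [joinGraph_adj_inl_inl, joinGraph_adj_inr_inr, joinGraph_adj_inl_inr,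
        joinGraph_adj_inr_inl, StarAdj]
    omega
  · intro i
    fin_cases i <;> simp [h₀, h₁, h₂, h₃, card_filter_sumElim]

theorem nonempty_iso_join_bot_sum_star {k l : ℕ} {S : Finset V} (hS : #S = k + 1)
    (hS' : #Sᶜ = l + 1) {a b : V} (ha : a ∈ S) (hb : b ∉ S)
    (hG : ∀ x y, G.Adj x y ↔ (x ≠ y ∧ (x ∈ S ∨ y ∈ S)) ∧ s(x, y) ≠ s(a, b)) :
    Nonempty (G ≃g joinGraph (⊤ : SimpleGraph (Fin k))
      ((⊥ : SimpleGraph (Fin 1)) ⊕g completeBipartiteGraph (Fin 1) (Fin l))) := by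
  obtain ⟨c, h₀, h₁, h₂, h₃, hc⟩ := exists_coloring_starAdj hS hS' ha hb hG
  refine nonempty_iso_of_coloring StarAdj hc
    (d := Sum.elim (fun _ => 0) (Sum.elim (fun _ => 3) (Sum.elim (fun _ => 1) (fun _ => 2)))) ?_ ?_
  · rintro (x | x | x | x) (y | y | y | y) <;>
      simp [joinGraph_adj_inl_inl, joinGraph_adj_inr_inr, joinGraph_adj_inl_inr,
        joinGraph_adj_inr_inl, StarAdj]
    omega
  · intro i
    fin_cases i <;> simp [h₀, h₁, h₂, h₃, card_filter_sumElim]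

end Isomorphisms

theorem SimpleGraph.exists_adj_iff_and_ne_of_card_edgeFinset {V : Type*} [Fintype V]
    [DecidableEq V] {G H : SimpleGraph V} [DecidableRel G.Adj] [DecidableRel H.Adj] (hGH : G ≤ H)
    (hcard : #H.edgeFinset = #G.edgeFinset + 1) :
    ∃ a b, H.Adj a b ∧ ∀ x y, G.Adj x y ↔ H.Adj x y ∧ s(x, y) ≠ s(a, b) := by
  have hsub : G.edgeFinset ⊆ H.edgeFinset := SimpleGraph.edgeFinset_subset_edgeFinset.2 hGH
  have h1 : #(H.edgeFinset \ G.edgeFinset) = 1 := by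
    rw [Finset.card_sdiff_of_subset hsub]
    omega
  obtain ⟨e, he⟩ := Finset.card_eq_one.1 h1
  induction e using Sym2.ind with
  | _ a b =>
    have hmem (x y : V) : H.Adj x y ∧ ¬ G.Adj x y ↔ s(x, y) = s(a, b) := by
      have := Finset.ext_iff.1 he s(x, y)
      simpa only [Finset.mem_sdiff, SimpleGraph.mem_edgeFinset, SimpleGraph.mem_edgeSet,
        Finset.mem_singleton] using this
    refine ⟨a, b, ((hmem a b).2 rfl).1, fun x y => ?_⟩
    have := hmem x y
    have := @hGH x y
    tauto

/-- A graph on `2k` vertices that is complete split, with clique and independent set of size `k`. -/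
theorem exists_finset_of_extremalAdj {V : Type*} [Fintype V] [DecidableEq V] {G : SimpleGraph V}
    {k : ℕ} (hcard : Fintype.card V = 2 * k) {c : V → Fin 3} (h₀ : #{x | c x = 0} = k)
    (h₂ : #{x | c x = 2} = 1) (hG : ∀ x y, G.Adj x y ↔ x ≠ y ∧ ExtremalAdj (c x) (c y)) :
    ∃ S : Finset V, #S = k ∧ #Sᶜ = k ∧ ∀ x y, G.Adj x y ↔ x ≠ y ∧ (x ∈ S ∨ y ∈ S) := by
  refine ⟨({x | c x = 0} : Finset V), h₀, by rw [Finset.card_compl, h₀]; omega, fun x y => ?_⟩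
  have h := Finset.card_le_one.1 h₂.le x
  have h := fun hx => h hx y
  simp only [Finset.mem_filter, Finset.mem_univ, true_and] at h
  rw [hG]
  simp only [ExtremalAdj, Finset.mem_filter, Finset.mem_univ, true_and]
  tauto

theorem IsHamiltonianConnected.exists_closed_of_not {V : Type*} [Fintype V] [DecidableEq V]
    {G : SimpleGraph V} (hG : ¬ IsHamiltonianConnected G) :
    ∃ H : SimpleGraph V, G ≤ H ∧ H ≠ ⊤ ∧ ∀ [DecidableRel H.Adj], ∀ u v, u ≠ v → ¬ H.Adj u v →
      H.degree u + H.degree v ≤ Fintype.card V := by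
  obtain ⟨H, hGH, hH⟩ := Finite.exists_le_maximal
    (p := fun H : SimpleGraph V => ¬ IsHamiltonianConnected H) hG
  refine ⟨H, hGH, ?_, ?_⟩
  · rintro rfl
    exact hH.prop isHamiltonianConnected_top
  · intro _ u v huv hadj
    by_contra! hdeg
    refine hH.prop (IsHamiltonianConnected.of_sup_edge hdeg ?_)
    by_contra hno
    have hle := hH.le_of_ge hno le_sup_left
    exact hadj (hle (Or.inr (by simp [SimpleGraph.edge_adj, huv])))

/-- Lemma 5: edge condition for Hamilton-connectedness with exceptional graphs. -/
theorem stmt_5 {V : Type*} [Fintype V] [DecidableEq V] (G : SimpleGraph V) [DecidableRel G.Adj]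
    (n : ℕ) (hn : Fintype.card V = n) (hn5 : 5 ≤ n)
    (hconn : G.Connected) (hδ : ∀ v : V, 3 ≤ G.degree v)
    (hm : Nat.choose (n - 2) 2 + 6 ≤ G.edgeFinset.card) :
    IsHamiltonianConnected G ∨
    Nonempty (G ≃g joinGraph (⊤ : SimpleGraph (Fin 3))
      ((⊤ : SimpleGraph (Fin (n - 5))) ⊕g (⊥ : SimpleGraph (Fin 2)))) ∨
    Nonempty (G ≃g joinGraph (⊤ : SimpleGraph (Fin 6)) (⊥ : SimpleGraph (Fin 6))) ∨
    Nonempty (G ≃g joinGraph (⊤ : SimpleGraph (Fin 4))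
      ((⊤ : SimpleGraph (Fin 2)) ⊕g (⊥ : SimpleGraph (Fin 3)))) ∨
    Nonempty (G ≃g joinGraph (⊤ : SimpleGraph (Fin 5)) (⊥ : SimpleGraph (Fin 5))) ∨
    Nonempty (G ≃g joinGraph (⊤ : SimpleGraph (Fin 4))
      (completeBipartiteGraph (Fin 1) (Fin 4) ⊕g (⊥ : SimpleGraph (Fin 1)))) ∨
    Nonempty (G ≃g joinGraph (⊤ : SimpleGraph (Fin 4))
      (completeBipartiteGraph (Fin 1) (Fin 3) ⊕g (⊤ : SimpleGraph (Fin 2)))) ∨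
    Nonempty (G ≃g joinGraph (⊤ : SimpleGraph (Fin 3))
      (completeBipartiteGraph (Fin 2) (Fin 5))) ∨
    Nonempty (G ≃g joinGraph (⊤ : SimpleGraph (Fin 4)) (⊥ : SimpleGraph (Fin 4))) ∨
    Nonempty (G ≃g joinGraph (⊤ : SimpleGraph (Fin 3))
      ((⊥ : SimpleGraph (Fin 1)) ⊕g completeBipartiteGraph (Fin 1) (Fin 3))) ∨
    Nonempty (G ≃g joinGraph (⊤ : SimpleGraph (Fin 3))
      (completeBipartiteGraph (Fin 1) (Fin 2) ⊕g (⊤ : SimpleGraph (Fin 2)))) ∨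
    Nonempty (G ≃g joinGraph (⊤ : SimpleGraph (Fin 2))
      (completeBipartiteGraph (Fin 2) (Fin 4))) := by
  by_cases hHC : IsHamiltonianConnected G
  · exact Or.inl hHC
  subst hn
  obtain ⟨H, hGH, hne, hclosed⟩ := IsHamiltonianConnected.exists_closed_of_not hHC
  classical
  have hsub : #G.edgeFinset ≤ #H.edgeFinset :=
    Finset.card_le_card (SimpleGraph.edgeFinset_subset_edgeFinset.2 hGH)
  have hδ' (v : V) : 3 ≤ H.degree v :=
    (hδ v).trans (SimpleGraph.degree_le_of_le hGH)
  have hm' : (Fintype.card V - 2) * (Fintype.card V - 3) + 12 ≤ 2 * #G.edgeFinset := by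
    have h : (Fintype.card V - 2).choose 2 * 2 =
        (Fintype.card V - 2) * (Fintype.card V - 2 - 1) := by
      rw [Nat.choose_two_right, Nat.div_mul_cancel (Nat.even_mul_pred_self _).two_dvd]
    rw [show Fintype.card V - 2 - 1 = Fintype.card V - 3 by omega] at h
    omega
  obtain ⟨k, hk, hkn, hshape, hmH, c, h₀, h₁, h₂, hH⟩ :=
    exists_coloring_of_degree_sum_le hclosed hne hδ' (by omega)
  have hGH_eq (h : #H.edgeFinset ≤ #G.edgeFinset) : G = H :=
    SimpleGraph.edgeFinset_inj.1
      (Finset.eq_of_subset_of_card_le (SimpleGraph.edgeFinset_subset_edgeFinset.2 hGH) h)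
  rcases hshape with rfl | ⟨hV, rfl⟩ | ⟨hV, rfl⟩ | ⟨hV, rfl⟩ | ⟨hV, rfl⟩
  · have hle : #H.edgeFinset ≤ #G.edgeFinset := by
      obtain ⟨j, hj⟩ := Nat.exists_eq_add_of_le hn5
      rw [hj] at hm' hmH
      have e1 : 5 + j - 2 = j + 3 := by omega
      have e2 : 5 + j - 3 = j + 2 := by omega
      have e3 : 5 + j - 1 = j + 4 := by omega
      have e4 : 5 + j - 2 * 3 + 1 = j := by omega
      rw [e1, e2] at hm'
      rw [e2, e3, e4] at hmH
      nlinarith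
    obtain rfl := hGH_eq hle
    rw [show Fintype.card V - 2 * 3 + 1 = Fintype.card V - 5 by omega] at h₂
    exact Or.inr (Or.inl (nonempty_iso_join_sum_top_bot h₀ h₁ h₂ hH))
  · rw [hV] at hm' hmH h₂
    obtain ⟨S, hS, hS', hHS⟩ := exists_finset_of_extremalAdj hV h₀ h₂ hH
    have hcases : #H.edgeFinset ≤ #G.edgeFinset ∨ #H.edgeFinset = #G.edgeFinset + 1 := by omega
    rcases hcases with h | h
    · obtain rfl := hGH_eq h
      iterate 8 apply Or.inr
      exact Or.inl (nonempty_iso_join_bot hS hS' hHS)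
    · obtain ⟨a, b, hab, hG⟩ := SimpleGraph.exists_adj_iff_and_ne_of_card_edgeFinset hGH h
      simp only [hHS] at hab hG
      by_cases ha : a ∈ S <;> by_cases hb : b ∈ S
      · iterate 11 apply Or.inr
        exact nonempty_iso_join_completeBipartite hS hS' ha hb hab.1 hG
      · iterate 9 apply Or.inr
        exact Or.inl (nonempty_iso_join_bot_sum_star hS hS' ha hb hG)
      · rw [Sym2.eq_swap (a := a)] at hG
        iterate 9 apply Or.inr
        exact Or.inl (nonempty_iso_join_bot_sum_star hS hS' hb ha hG)
      · exact absurd hab.2 (by simp [ha, hb])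
  · rw [hV] at hm' hmH h₂
    obtain rfl := hGH_eq (by omega)
    iterate 3 apply Or.inr
    exact Or.inl (nonempty_iso_join_sum_top_bot h₀ h₁ h₂ hH)
  · rw [hV] at hm' hmH h₂
    obtain ⟨S, hS, hS', hHS⟩ := exists_finset_of_extremalAdj hV h₀ h₂ hH
    have hcases : #H.edgeFinset ≤ #G.edgeFinset ∨ #H.edgeFinset = #G.edgeFinset + 1 := by omega
    rcases hcases with h | h
    · obtain rfl := hGH_eq h
      iterate 4 apply Or.inr
      exact Or.inl (nonempty_iso_join_bot hS hS' hHS)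
    · obtain ⟨a, b, hab, hG⟩ := SimpleGraph.exists_adj_iff_and_ne_of_card_edgeFinset hGH h
      simp only [hHS] at hab hG
      by_cases ha : a ∈ S <;> by_cases hb : b ∈ S
      · iterate 7 apply Or.inr
        exact Or.inl (nonempty_iso_join_completeBipartite hS hS' ha hb hab.1 hG)
      · iterate 5 apply Or.inr
        exact Or.inl (nonempty_iso_join_star_sum_bot hS hS' ha hb hG)
      · rw [Sym2.eq_swap (a := a)] at hG
        iterate 5 apply Or.inr
        exact Or.inl (nonempty_iso_join_star_sum_bot hS hS' hb ha hG)
      · exact absurd hab.2 (by simp [ha, hb])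
  · rw [hV] at hm' hmH h₂
    obtain rfl := hGH_eq (by omega)
    obtain ⟨S, hS, hS', hHS⟩ := exists_finset_of_extremalAdj hV h₀ h₂ hH
    iterate 2 apply Or.inr
    exact Or.inl (nonempty_iso_join_bot hS hS' hHS)
end

section
/- Let G be a connected graph on n ≥ 5 vertices with minimum degree δ(G) ≥ 3. If ρ_D(G) ≤ (2n² + 6n − 36)/n, then G is Hamilton-connected. -/
open SimpleGraph Finset

namespace SimpleGraph

lemma exists_walk_support_eq_map {V : Type*} {G : SimpleGraph V} (p : ℕ → V) (m : ℕ)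
    (hp : ∀ i < m, G.Adj (p i) (p (i + 1))) :
    ∃ w : G.Walk (p 0) (p m), w.support = (List.range (m + 1)).map p := by
  induction m with
  | zero => exact ⟨.nil, by simp⟩
  | succ m ih =>
    obtain ⟨w, hw⟩ := ih fun i hi => hp i (by omega)
    refine ⟨w.concat (hp m (by omega)), ?_⟩
    rw [Walk.support_concat, hw, List.range_succ (n := m + 1)]
    simp

variable {V : Type*} [Fintype V] [DecidableEq V]

lemma exists_isHamiltonian_of_injOn {G : SimpleGraph V} (p : ℕ → V)
    (hinj : Set.InjOn p (Set.Iio (Fintype.card V)))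
    (hp : ∀ i, i + 1 < Fintype.card V → G.Adj (p i) (p (i + 1))) :
    ∃ w : G.Walk (p 0) (p (Fintype.card V - 1)), w.IsHamiltonian := by
  have hpos : 0 < Fintype.card V := Fintype.card_pos_iff.2 ⟨p 0⟩
  obtain ⟨w, hw⟩ := exists_walk_support_eq_map p (Fintype.card V - 1)
    fun i hi => hp i (by omega)
  refine ⟨w, Walk.isHamiltonian_iff_isPath_and_length_eq.2 ⟨Walk.IsPath.mk' ?_, ?_⟩⟩
  · rw [hw]
    refine List.Nodup.map_on (fun x hx y hy h => hinj ?_ ?_ h) List.nodup_range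
    all_goals simp only [List.mem_range, Set.mem_Iio] at *; omega
  · have := congrArg List.length hw
    simpa using this

/-- Reversing the segment `[l, h]` of a spanning sequence which is a path except possibly at the
two ends of that segment gives a Hamilton path, if the reversed segment fits. -/
lemma exists_isHamiltonian_of_reverse_segment {G : SimpleGraph V} (p : ℕ → V) (l h : ℕ)
    (hl : 1 ≤ l) (hlh : l ≤ h) (hh : h + 1 < Fintype.card V)
    (hinj : Set.InjOn p (Set.Iio (Fintype.card V)))
    (hp : ∀ i, i + 1 < Fintype.card V → i + 1 ≠ l → i ≠ h → G.Adj (p i) (p (i + 1)))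
    (hleft : G.Adj (p (l - 1)) (p h)) (hright : G.Adj (p l) (p (h + 1))) :
    ∃ w : G.Walk (p 0) (p (Fintype.card V - 1)), w.IsHamiltonian := by
  let r : ℕ → ℕ := fun t => if l ≤ t ∧ t ≤ h then l + h - t else t
  have hr : ∀ t, r t = if l ≤ t ∧ t ≤ h then l + h - t else t := fun _ => rfl
  have key := exists_isHamiltonian_of_injOn (G := G) (p ∘ r) ?_ ?_
  · have h0 : r 0 = 0 := by grind
    have h1 : r (Fintype.card V - 1) = Fintype.card V - 1 := by grind
    rwa [Function.comp_apply, Function.comp_apply, h0, h1] at key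
  · refine hinj.comp (fun x hx y hy hxy => ?_) fun x hx => ?_
    · grind
    · simp only [Set.mem_Iio] at *
      grind
  · intro i hi
    simp only [Function.comp]
    by_cases hin : l ≤ i ∧ i < h
    · have e1 : r i = (l + h - (i + 1)) + 1 := by grind
      have e2 : r (i + 1) = l + h - (i + 1) := by grind
      rw [e1, e2]
      exact (hp _ (by omega) (by omega) (by omega)).symm
    · by_cases hil : i + 1 = l
      · have e1 : r i = l - 1 := by grind
        have e2 : r (i + 1) = h := by grind
        rwa [e1, e2]
      · by_cases hih : i = h
        · have e1 : r i = l := by grind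
          have e2 : r (i + 1) = h + 1 := by grind
          rwa [e1, e2]
        · have e1 : r i = i := by grind
          have e2 : r (i + 1) = i + 1 := by grind
          rw [e1, e2]
          exact hp i hi hil hih

/-- Crossing argument: a Hamilton path using a missing edge `uv` with large degree sum can be
rerouted. -/
lemma exists_isHamiltonian_of_le_degree_add_degree {G : SimpleGraph V} [DecidableRel G.Adj]
    (p : ℕ → V) (hinj : Set.InjOn p (Set.Iio (Fintype.card V))) (j : ℕ)
    (hj : j + 1 < Fintype.card V)
    (hp : ∀ i, i + 1 < Fintype.card V → i ≠ j → G.Adj (p i) (p (i + 1)))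
    (hdeg : Fintype.card V + 1 ≤ G.degree (p j) + G.degree (p (j + 1))) :
    ∃ w : G.Walk (p 0) (p (Fintype.card V - 1)), w.IsHamiltonian := by
  set n := Fintype.card V with hn
  by_cases hadj : G.Adj (p j) (p (j + 1))
  · refine exists_isHamiltonian_of_injOn p hinj fun i hi => ?_
    by_cases hij : i = j
    · exact hij ▸ hadj
    · exact hp i hi hij
  have hsurj : ∀ x, ∃ i < n, p i = x := by
    have himg : (range n).image p = univ := by
      rw [← card_eq_iff_eq_univ, card_image_of_injOn, card_range]
      simpa [Set.InjOn] using hinj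
    intro x
    simpa using himg.ge (mem_univ x)
  let A := (range (n - 1)).filter fun k => G.Adj (p j) (p k)
  let B := (range (n - 1)).filter fun k => G.Adj (p (j + 1)) (p (k + 1))
  have hA : G.degree (p j) ≤ #A + 1 := by
    rw [← card_neighborFinset_eq_degree]
    have : G.neighborFinset (p j) ⊆ insert (p (n - 1)) (A.image p) := by
      intro x hx
      obtain ⟨i, hi, rfl⟩ := hsurj x
      rw [mem_neighborFinset] at hx
      by_cases h : i = n - 1
      · simp [h]
      · exact mem_insert_of_mem (mem_image_of_mem _ (by simp [A, hx]; omega))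
    exact (card_le_card this).trans ((card_insert_le _ _).trans
      (Nat.add_le_add_right card_image_le 1))
  have hB : G.degree (p (j + 1)) ≤ #B + 1 := by
    rw [← card_neighborFinset_eq_degree]
    have : G.neighborFinset (p (j + 1)) ⊆ insert (p 0) (B.image fun k => p (k + 1)) := by
      intro x hx
      obtain ⟨i, hi, rfl⟩ := hsurj x
      rw [mem_neighborFinset] at hx
      rcases i with _ | i
      · simp
      · exact mem_insert_of_mem (mem_image.2 ⟨i, by simp [B, hx]; omega, rfl⟩)
    exact (card_le_card this).trans ((card_insert_le _ _).trans
      (Nat.add_le_add_right card_image_le 1))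
  have hAB : A ∪ B ⊆ (range (n - 1)).erase j := by
    intro k hk
    rcases mem_union.1 hk with hk | hk <;> simp only [A, B, mem_filter, mem_range] at hk <;>
      simp only [mem_erase, mem_range] <;> refine ⟨?_, hk.1⟩ <;> rintro rfl <;>
      exact G.loopless.irrefl _ hk.2
  have hcard := card_le_card hAB
  rw [card_erase_of_mem (by simp; omega), card_range] at hcard
  have hint := card_union_add_card_inter A B
  obtain ⟨k, hk⟩ : (A ∩ B).Nonempty := card_pos.1 (by omega)
  simp only [A, B, mem_inter, mem_filter, mem_range] at hk
  obtain ⟨⟨hk1, hkA⟩, -, hkB⟩ := hk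
  have hkj : k ≠ j := by rintro rfl; exact G.loopless.irrefl _ hkA
  rcases lt_or_gt_of_ne hkj with hlt | hgt
  · exact exists_isHamiltonian_of_reverse_segment p (k + 1) j (by omega) (by omega) hj hinj
      (fun i hi _ hij => hp i hi hij) hkA.symm hkB.symm
  · exact exists_isHamiltonian_of_reverse_segment p (j + 1) k (by omega) (by omega) (by omega) hinj
      (fun i hi hij _ => hp i hi (by omega)) hkA hkB

/-- Bondy–Chvátal closure step for Hamilton-connectedness. -/
lemma isHamiltonianConnected_of_sup_edge {G : SimpleGraph V} [DecidableRel G.Adj] {u v : V}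
    (hdeg : Fintype.card V + 1 ≤ G.degree u + G.degree v)
    (h : IsHamiltonianConnected (G ⊔ edge u v)) : IsHamiltonianConnected G := by
  intro a b hab
  obtain ⟨w, hw⟩ := h a b hab
  have hlen := hw.length_eq
  have hinj : Set.InjOn w.getVert (Set.Iio (Fintype.card V)) := by
    refine hw.isPath.getVert_injOn.mono fun i hi => ?_
    simp only [Set.mem_Iio, Set.mem_ofPred_eq] at *
    omega
  have hadj : ∀ i, i + 1 < Fintype.card V → G.Adj (w.getVert i) (w.getVert (i + 1)) ∨
      (w.getVert i = u ∧ w.getVert (i + 1) = v ∨ w.getVert i = v ∧ w.getVert (i + 1) = u) := by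
    intro i hi
    have := w.adj_getVert_succ (i := i) (by omega)
    rw [sup_adj, edge_adj] at this
    tauto
  suffices ∃ w' : G.Walk (w.getVert 0) (w.getVert (Fintype.card V - 1)), w'.IsHamiltonian by
    have e : w.getVert (Fintype.card V - 1) = b := by rw [← hlen, w.getVert_length]
    rwa [w.getVert_zero, e] at this
  by_cases hall : ∀ i, i + 1 < Fintype.card V → G.Adj (w.getVert i) (w.getVert (i + 1))
  · exact exists_isHamiltonian_of_injOn _ hinj hall
  push Not at hall
  obtain ⟨j, hj, hnj⟩ := hall
  have hjuv := (hadj j hj).resolve_left hnj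
  refine exists_isHamiltonian_of_le_degree_add_degree _ hinj j hj (fun i hi hij => ?_) ?_
  · refine (hadj i hi).resolve_right fun hiuv => ?_
    have inj : ∀ x y, x < Fintype.card V → y < Fintype.card V →
      w.getVert x = w.getVert y → x = y := fun x y hx hy hxy => hinj hx hy hxy
    have h1 := inj i j (by omega) (by omega)
    have h2 := inj i (j + 1) (by omega) (by omega)
    have h3 := inj (i + 1) j (by omega) (by omega)
    grind
  · rcases hjuv with ⟨h1, h2⟩ | ⟨h1, h2⟩ <;> rw [h1, h2] <;> omega

lemma isHamiltonianConnected_top : IsHamiltonianConnected (⊤ : SimpleGraph V) := by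
  intro a b hab
  have hcard : 1 < Fintype.card V := Fintype.one_lt_card_iff.2 ⟨a, b, hab⟩
  obtain ⟨e⟩ : Nonempty (Fin (Fintype.card V) ≃ V) := ⟨(Fintype.equivFin V).symm⟩
  let s : Fin (Fintype.card V) := ⟨0, by omega⟩
  let t : Fin (Fintype.card V) := ⟨Fintype.card V - 1, by omega⟩
  have hst : s ≠ t := by simp [s, t, Fin.ext_iff]; omega
  let e₁ := e.trans (Equiv.swap (e s) a)
  have hs₁ : e₁ s = a := by simp [e₁]
  let e₂ := e₁.trans (Equiv.swap (e₁ t) b)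
  have ht₂ : e₂ t = b := by simp [e₂]
  have hs₂ : e₂ s = a := by
    simp only [e₂, Equiv.trans_apply]
    rw [hs₁, Equiv.swap_apply_of_ne_of_ne _ hab]
    rw [← hs₁]
    exact fun h => hst (e₁.injective h)
  let p : ℕ → V := fun i => if h : i < Fintype.card V then e₂ ⟨i, h⟩ else a
  have hpe : ∀ i (h : i < Fintype.card V), p i = e₂ ⟨i, h⟩ := fun i h => dif_pos h
  have hinj : Set.InjOn p (Set.Iio (Fintype.card V)) := by
    intro x hx y hy hxy
    rw [hpe x hx, hpe y hy] at hxy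
    exact congrArg Fin.val (e₂.injective hxy)
  have key := exists_isHamiltonian_of_injOn (G := ⊤) p hinj fun i hi => by
    rw [top_adj]
    intro h
    have := hinj (show i < _ by omega) hi h
    omega
  rwa [hpe 0 (by omega), hpe (Fintype.card V - 1) (by omega), hs₂, ht₂] at key

/-- Degree consequence of failing to be Hamilton-connected, in the style of Chvátal and Berge. -/
lemma exists_degree_bounds_of_not_isHamiltonianConnected {G : SimpleGraph V} [DecidableRel G.Adj]
    (h : ¬ IsHamiltonianConnected G) :
    ∃ i, (∃ u, G.degree u ≤ i) ∧ 2 * i ≤ Fintype.card V ∧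
      i ≤ #{w | G.degree w ≤ i} + 1 ∧
      Fintype.card V ≤ #{w | G.degree w ≤ Fintype.card V - i} + i := by
  classical
  obtain ⟨H, hGH, hH⟩ :=
    Finite.exists_le_maximal (p := fun H : SimpleGraph V => ¬ IsHamiltonianConnected H) h
  have hle : ∀ w, G.degree w ≤ H.degree w := fun w => degree_le_of_le hGH
  have hsum : ∀ u v, u ≠ v → ¬ H.Adj u v → H.degree u + H.degree v ≤ Fintype.card V := by
    intro u v huv hnadj
    by_contra! hlt
    refine hH.1 (isHamiltonianConnected_of_sup_edge hlt ?_)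
    by_contra hnot
    have : (H ⊔ edge u v).Adj u v := by
      rw [sup_adj, edge_adj]
      exact .inr ⟨.inl ⟨rfl, rfl⟩, huv⟩
    exact hnadj (hH.2 hnot le_sup_left this)
  let S : Finset (V × V) := {q | q.1 ≠ q.2 ∧ ¬ H.Adj q.1 q.2 ∧ H.degree q.1 ≤ H.degree q.2}
  have hS : S.Nonempty := by
    have hne : H ≠ ⊤ := by
      intro hT
      exact hH.1 (hT ▸ isHamiltonianConnected_top)
    obtain ⟨u, v, huv, hnadj⟩ := ne_top_iff_exists_not_adj.1 hne
    rcases le_total (H.degree u) (H.degree v) with hd | hd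
    · exact ⟨(u, v), by simp [S, huv, hnadj, hd]⟩
    · exact ⟨(v, u), by simp [S, huv.symm, H.adj_comm v u, hnadj, hd]⟩
  obtain ⟨⟨u, v⟩, huv, hmax⟩ := exists_max_image S (fun q => H.degree q.1 + H.degree q.2) hS
  simp only [S, mem_filter, mem_univ, true_and] at huv hmax
  obtain ⟨hne, hnadj, hd⟩ := huv
  have huv := hsum u v hne hnadj
  have hmax' : ∀ x y, x ≠ y → ¬ H.Adj x y →
      H.degree x + H.degree y ≤ H.degree u + H.degree v := by
    intro x y hxy hn
    rcases le_total (H.degree x) (H.degree y) with hd | hd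
    · exact hmax (x, y) ⟨hxy, hn, hd⟩
    · have := hmax (y, x) ⟨hxy.symm, fun h => hn h.symm, hd⟩
      simp only at this
      omega
  have hcompl : ∀ x, #(H.neighborFinset x)ᶜ + H.degree x = Fintype.card V := by
    intro x
    rw [← card_neighborFinset_eq_degree, card_compl_add_card]
  refine ⟨H.degree u, ⟨u, hle u⟩, by omega, ?_, ?_⟩
  · have hsub : (H.neighborFinset v)ᶜ ⊆ insert v ({w | G.degree w ≤ H.degree u} : Finset V) := by
      intro w hw
      simp only [mem_compl, mem_neighborFinset, mem_insert, mem_filter, mem_univ, true_and] at *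
      by_cases hwv : w = v
      · exact .inl hwv
      · have := hmax' w v hwv fun h => hw h.symm
        have := hle w
        right
        omega
    have := (card_le_card hsub).trans (card_insert_le _ _)
    have := hcompl v
    omega
  · have hsub : (H.neighborFinset u)ᶜ ⊆
        ({w | G.degree w ≤ Fintype.card V - H.degree u} : Finset V) := by
      intro w hw
      simp only [mem_compl, mem_neighborFinset, mem_filter, mem_univ, true_and] at *
      have := hle w
      by_cases hwu : w = u
      · subst hwu
        omega
      · have := hsum u w (Ne.symm hwu) hw
        omega
    have := card_le_card hsub
    have := hcompl u
    omega

omit [DecidableEq V] in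
lemma sum_degree_add_le {G : SimpleGraph V} [DecidableRel G.Adj] {i : ℕ} (hi : 1 ≤ i)
    (h2 : 2 * i ≤ Fintype.card V) (h₁ : i ≤ #{w | G.degree w ≤ i} + 1)
    (h₂ : Fintype.card V ≤ #{w | G.degree w ≤ Fintype.card V - i} + i) :
    (∑ w, (G.degree w : ℤ)) + (i - 1) * (2 * Fintype.card V - 3 * i) ≤
      Fintype.card V * (Fintype.card V - 1) := by
  set n := Fintype.card V with hn
  have hpt : ∀ w, (G.degree w : ℤ) ≤ (n - 1) - (if G.degree w ≤ n - i then (i - 1 : ℤ) else 0) -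
      (if G.degree w ≤ i then (n - 2 * i : ℤ) else 0) := by
    intro w
    have := G.degree_lt_card_verts w
    grind
  have hs := sum_le_sum fun w (_ : w ∈ univ) => hpt w
  simp only [sum_sub_distrib, ← sum_filter, sum_const, nsmul_eq_mul, card_univ, ← hn] at hs
  have hz₁ : (i : ℤ) ≤ #{w | G.degree w ≤ i} + 1 := by exact_mod_cast h₁
  have hz₂ : (n : ℤ) ≤ #{w | G.degree w ≤ n - i} + i := by exact_mod_cast h₂
  have hz2 : (2 * i : ℤ) ≤ n := by exact_mod_cast h2
  have hzi : (1 : ℤ) ≤ i := by exact_mod_cast hi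
  nlinarith [mul_nonneg (sub_nonneg.2 hz₁) (sub_nonneg.2 hz2),
    mul_nonneg (sub_nonneg.2 hz₂) (sub_nonneg.2 hzi)]

lemma isHermitian_distSignlessLaplacian (G : SimpleGraph V) :
    (distSignlessLaplacian G).IsHermitian := by
  ext u v
  by_cases h : u = v
  · simp [h]
  · simp [distSignlessLaplacian, h, Ne.symm h, G.dist_comm]

lemma posSemidef_sub_distSignlessLaplacian {G : SimpleGraph V} {ρ : ℝ}
    (hρ : IsDistSLSpectralRadius G ρ) :
    (ρ • (1 : Matrix V V ℝ) - distSignlessLaplacian G).PosSemidef := by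
  have hH : (ρ • (1 : Matrix V V ℝ) - distSignlessLaplacian G).IsHermitian :=
    (Matrix.isHermitian_one.smul (IsSelfAdjoint.all ρ)).sub (isHermitian_distSignlessLaplacian G)
  rw [hH.posSemidef_iff_eigenvalues_nonneg]
  intro i
  set w : V → ℝ := (hH.eigenvectorBasis i).ofLp
  have hw : w ≠ 0 := fun h => hH.eigenvectorBasis.orthonormal.ne_zero i (by ext j; exact congrFun h j)
  have hev := hH.mulVec_eigenvectorBasis i
  have : ρ - hH.eigenvalues i ≤ ρ := by
    refine hρ.2 (Module.End.hasEigenvalue_of_hasEigenvector (x := w)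
      ⟨Module.End.mem_eigenspace_iff.2 ?_, hw⟩)
    rw [Matrix.sub_mulVec, Matrix.smul_mulVec, Matrix.one_mulVec] at hev
    rw [Matrix.toLin'_apply, sub_smul]
    exact eq_sub_of_add_eq' (sub_eq_iff_eq_add.1 hev).symm
  simpa using this

lemma mulVec_distSignlessLaplacian_apply (G : SimpleGraph V) (x : V → ℝ) (u : V) :
    (distSignlessLaplacian G).mulVec x u = ∑ v, (G.dist u v : ℝ) * (x u + x v) := by
  simp only [Matrix.mulVec, dotProduct, distSignlessLaplacian, add_mul, mul_add, sum_add_distrib,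
    ite_mul, zero_mul, sum_ite_eq, mem_univ, if_true, transmission, Nat.cast_sum, sum_mul]

lemma sum_dist_mul_le {G : SimpleGraph V} {ρ : ℝ} (hρ : IsDistSLSpectralRadius G ρ) (x : V → ℝ) :
    ∑ u, x u * ∑ v, (G.dist u v : ℝ) * (x u + x v) ≤ ρ * ∑ u, x u ^ 2 := by
  have h := (posSemidef_sub_distSignlessLaplacian hρ).dotProduct_mulVec_nonneg x
  simp only [Matrix.sub_mulVec, Matrix.smul_mulVec, Matrix.one_mulVec, star_trivial, dotProduct,
    Pi.sub_apply, Pi.smul_apply, smul_eq_mul, mul_sub, sum_sub_distrib,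
    mulVec_distSignlessLaplacian_apply, sub_nonneg] at h
  refine h.trans_eq ?_
  rw [mul_sum]
  exact sum_congr rfl fun u _ => by ring

variable {G : SimpleGraph V} [DecidableRel G.Adj]

omit [Fintype V] in
lemma Connected.le_dist (hG : G.Connected) (u v : V) :
    (1 - if u = v then (1 : ℝ) else 0) + (if Gᶜ.Adj u v then 1 else 0) ≤ G.dist u v := by
  by_cases huv : u = v
  · simp [huv]
  by_cases hadj : G.Adj u v
  · simp [huv, hadj, dist_eq_one_iff_adj.2 hadj]
  · have : 2 ≤ G.dist u v := hG.one_lt_dist_of_ne_of_not_adj huv hadj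
    have : (2 : ℝ) ≤ G.dist u v := by exact_mod_cast this
    simp only [huv, compl_adj, hadj, ne_eq, not_false_eq_true, and_self, if_true, if_false]
    linarith

lemma sum_compl_adj (u : V) :
    ∑ v, (if Gᶜ.Adj u v then (1 : ℝ) else 0) = Fintype.card V - 1 - G.degree u := by
  rw [sum_boole, ← neighborFinset_eq_filter, card_neighborFinset_eq_degree, degree_compl]
  have := G.degree_lt_card_verts u
  rw [Nat.cast_sub (by omega), Nat.cast_sub (by omega)]
  simp

lemma Connected.le_transmission (hG : G.Connected) (u : V) :
    2 * ((Fintype.card V : ℝ) - 1) - G.degree u ≤ transmission G u := by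
  have h := sum_le_sum fun v (_ : v ∈ univ) => hG.le_dist u v
  rw [sum_add_distrib, sum_compl_adj] at h
  simp only [sum_sub_distrib, sum_const, card_univ, nsmul_eq_mul, mul_one, sum_ite_eq, mem_univ,
    if_true] at h
  rw [transmission, Nat.cast_sum]
  linarith

lemma sum_transmission_le {G : SimpleGraph V} {ρ : ℝ} (hρ : IsDistSLSpectralRadius G ρ) :
    2 * ∑ u, (transmission G u : ℝ) ≤ ρ * Fintype.card V := by
  have h := sum_dist_mul_le hρ fun _ => 1
  simp only [one_mul, ← sum_mul, one_pow, sum_const, card_univ, nsmul_eq_mul, mul_one] at h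
  simp only [transmission, Nat.cast_sum]
  linarith

lemma transmission_eq_of_sum_transmission_eq {G : SimpleGraph V} {ρ : ℝ}
    (hρ : IsDistSLSpectralRadius G ρ)
    (h : 2 * ∑ u, (transmission G u : ℝ) = ρ * Fintype.card V) (u : V) :
    2 * (transmission G u : ℝ) = ρ := by
  have hone : ∀ u, (distSignlessLaplacian G).mulVec (fun _ => 1) u = 2 * (transmission G u : ℝ) := by
    intro u
    rw [mulVec_distSignlessLaplacian_apply, ← sum_mul, transmission, Nat.cast_sum]
    ring
  have hz := ((posSemidef_sub_distSignlessLaplacian hρ).dotProduct_mulVec_zero_iff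
    fun _ => 1).1 (by
      simp only [Matrix.sub_mulVec, Matrix.smul_mulVec, Matrix.one_mulVec, star_trivial,
        dotProduct, Pi.sub_apply, Pi.smul_apply, smul_eq_mul, hone, one_mul, mul_one,
        sum_sub_distrib, sum_const, card_univ, nsmul_eq_mul, ← mul_sum, h]
      ring)
  have := congrFun hz u
  simp only [Matrix.sub_mulVec, Matrix.smul_mulVec, Matrix.one_mulVec, Pi.sub_apply,
    Pi.smul_apply, smul_eq_mul, hone, mul_one, Pi.zero_apply] at this
  linarith

lemma Connected.sum_degree_ge (hG : G.Connected) {ρ : ℝ} (hρ : IsDistSLSpectralRadius G ρ) :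
    2 * (2 * (Fintype.card V : ℝ) * (Fintype.card V - 1) - ∑ u, (G.degree u : ℝ)) ≤
      ρ * Fintype.card V := by
  refine le_trans ?_ (sum_transmission_le hρ)
  have h := sum_le_sum fun u (_ : u ∈ univ) => hG.le_transmission u
  simp only [sum_sub_distrib, sum_const, card_univ, nsmul_eq_mul] at h
  linarith

lemma Connected.degree_eq_of_sum_degree_eq (hG : G.Connected) {ρ : ℝ}
    (hρ : IsDistSLSpectralRadius G ρ)
    (h : 2 * (2 * (Fintype.card V : ℝ) * (Fintype.card V - 1) - ∑ u, (G.degree u : ℝ)) =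
      ρ * Fintype.card V) (u v : V) : G.degree u = G.degree v := by
  have hle := fun u (_ : u ∈ univ) => hG.le_transmission u
  have hs := sum_le_sum hle
  have hl : ∑ u, (2 * ((Fintype.card V : ℝ) - 1) - G.degree u) =
      2 * (Fintype.card V : ℝ) * (Fintype.card V - 1) - ∑ u, (G.degree u : ℝ) := by
    simp only [sum_sub_distrib, sum_const, card_univ, nsmul_eq_mul]
    ring
  have ht := sum_transmission_le hρ
  have heq := (sum_eq_sum_iff_of_le hle).1 (by linarith)
  have hreg := transmission_eq_of_sum_transmission_eq hρ (by linarith)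
  have h1 := heq u (mem_univ u)
  have h2 := heq v (mem_univ v)
  have h3 := hreg u
  have h4 := hreg v
  have : (G.degree u : ℝ) = G.degree v := by linarith
  exact_mod_cast this

/-- A spectral radius bound from the test vector equal to `2` on half of the vertices, all of
degree at most `n / 2`, and to `1` elsewhere. -/
lemma Connected.spectralRadius_ge_of_half (hG : G.Connected) {ρ : ℝ}
    (hρ : IsDistSLSpectralRadius G ρ) {S : Finset V} (hS : Fintype.card V = 2 * #S)
    (hdeg : ∀ u ∈ S, G.degree u ≤ #S) :
    27 * (#S : ℝ) ^ 2 - 18 * #S ≤ ρ * (5 * #S) := by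
  let f : V → ℝ := fun u => if u ∈ S then 1 else 0
  let N : V → V → ℝ := fun u v => if Gᶜ.Adj u v then 1 else 0
  have hf : ∀ u, f u = 0 ∨ f u = 1 := fun u => by by_cases h : u ∈ S <;> simp [f, h]
  have hff : ∀ u, f u ^ 2 = f u := fun u => by rcases hf u with h | h <;> simp [h]
  have hfS : ∑ u, f u = #S := by simp [f]
  have hn : (Fintype.card V : ℝ) = 2 * #S := by exact_mod_cast hS
  have hcard : ∑ _u : V, (1 : ℝ) = 2 * #S := by simp [hn]
  have hsq : ∑ u, (1 + f u) ^ 2 = 5 * (#S : ℝ) := by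
    have : ∀ u, (1 + f u) ^ 2 = 1 + 3 * f u := fun u => by linear_combination hff u
    simp only [this, sum_add_distrib, ← mul_sum, hfS, hcard]
    ring
  have hrow : #S * ((#S : ℝ) - 1) ≤ ∑ u, f u * ∑ v, N u v := by
    have : ∀ u ∈ univ, f u * ((#S : ℝ) - 1) ≤ f u * ∑ v, N u v := by
      intro u _
      by_cases h : u ∈ S
      · have : (G.degree u : ℝ) ≤ #S := by exact_mod_cast hdeg u h
        simp only [f, h, if_true, N, sum_compl_adj]
        linarith
      · simp [f, h]
    have := sum_le_sum this
    rwa [← sum_mul, hfS] at this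
  have hcol : ∑ u, ∑ v, N u v * f v = ∑ u, f u * ∑ v, N u v := by
    rw [sum_comm]
    refine sum_congr rfl fun u _ => ?_
    rw [mul_sum]
    exact sum_congr rfl fun v _ => by
      rw [mul_comm]
      simp only [N, Gᶜ.adj_comm v u]
  have hpt : ∀ u ∈ univ, (1 + f u) * (2 * #S * (1 + f u) + 3 * #S - 2 * (1 + f u)) +
      (5 * (f u * ∑ v, N u v) + 3 * ∑ v, N u v * f v) ≤
      (1 + f u) * ∑ v, (G.dist u v : ℝ) * ((1 + f u) + (1 + f v)) := by
    intro u _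
    have h1 : ∀ v ∈ univ, (1 + f u) * ((1 + f u) + (1 + f v)) -
        (if u = v then (1 + f u) * ((1 + f u) + (1 + f v)) else 0) +
        (5 * (f u * N u v) + 3 * (N u v * f v)) ≤
        (1 + f u) * ((G.dist u v : ℝ) * ((1 + f u) + (1 + f v))) := by
      intro v _
      have hd := hG.le_dist u v
      have hN : 0 ≤ N u v := by simp only [N]; split_ifs <;> norm_num
      change _ + N u v ≤ _ at hd
      have hpos : 0 ≤ (1 + f u) * ((1 + f u) + (1 + f v)) := by
        rcases hf u with h | h <;> rcases hf v with h' | h' <;> rw [h, h'] <;> norm_num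
      have hm := mul_le_mul_of_nonneg_right hd hpos
      have hc : 5 * (f u * N u v) + 3 * (N u v * f v) ≤
          N u v * ((1 + f u) * ((1 + f u) + (1 + f v))) := by
        rcases hf u with h | h <;> rcases hf v with h' | h' <;> rw [h, h'] <;> linarith
      by_cases huv : u = v
      · simp only [huv, if_true] at *
        linarith
      · simp only [huv, if_false] at *
        linarith
    have h2 := sum_le_sum h1
    simp only [sum_add_distrib, sum_sub_distrib, ← mul_sum, sum_ite_eq, mem_univ, if_true,
      hfS, sum_const, card_univ, nsmul_eq_mul, hn] at h2 ⊢
    linarith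
  have hq := sum_dist_mul_le hρ fun u => 1 + f u
  rw [hsq] at hq
  refine le_trans ?_ hq
  refine le_trans ?_ (sum_le_sum hpt)
  have hpoly : ∀ u, (1 + f u) * (2 * #S * (1 + f u) + 3 * #S - 2 * (1 + f u)) =
      (5 * #S - 2) + (9 * #S - 6) * f u := fun u => by
    linear_combination (2 * (#S : ℝ) - 2) * hff u
  simp only [sum_add_distrib, hpoly, ← mul_sum, hfS, hcol, sum_const, card_univ, nsmul_eq_mul,
    hn]
  linarith

end SimpleGraph

/-- Theorem 6: spectral condition for Hamilton-connectedness. -/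
theorem stmt_6 {V : Type*} [Fintype V] [DecidableEq V] (G : SimpleGraph V) [DecidableRel G.Adj]
    (hconn : G.Connected) (hn : 5 ≤ Fintype.card V)
    (hδ : ∀ v : V, 3 ≤ G.degree v)
    (ρ : ℝ) (hρ : IsDistSLSpectralRadius G ρ)
    (hle : ρ ≤ (2 * (Fintype.card V : ℝ) ^ 2 + 6 * (Fintype.card V : ℝ) - 36) /
      (Fintype.card V : ℝ)) :
    IsHamiltonianConnected G := by
  by_contra hnot
  obtain ⟨i, ⟨u, hu⟩, h2, h₁, h₂⟩ := exists_degree_bounds_of_not_isHamiltonianConnected hnot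
  have hi : 3 ≤ i := (hδ u).trans hu
  have hsum := sum_degree_add_le (by omega) h2 h₁ h₂
  have hge := hconn.sum_degree_ge hρ
  set n := Fintype.card V with hn
  have hρn : ρ * n ≤ 2 * (n : ℝ) ^ 2 + 6 * n - 36 := by
    rwa [le_div_iff₀ (by positivity)] at hle
  have hlow : (n : ℤ) ^ 2 - 5 * n + 18 ≤ ∑ w, (G.degree w : ℤ) := by
    have : (n : ℝ) ^ 2 - 5 * n + 18 ≤ ∑ w, (G.degree w : ℝ) := by linarith
    exact_mod_cast this
  by_cases hcase : (3 * i + 6 : ℤ) ≤ 2 * n ∨ i = 3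
  · have hprod : 0 ≤ ((i : ℤ) - 3) * (2 * n - 3 * i - 6) := by
      rcases hcase with h | h
      · exact mul_nonneg (by omega) (by omega)
      · simp [h]
    have heq : ∑ w, (G.degree w : ℤ) = (n : ℤ) ^ 2 - 5 * n + 18 := by linarith
    have heq' : ∑ w, (G.degree w : ℝ) = (n : ℝ) ^ 2 - 5 * n + 18 := by exact_mod_cast heq
    have hreg := hconn.degree_eq_of_sum_degree_eq hρ (le_antisymm hge (by linarith))
    have hconst : ∑ w, (G.degree w : ℤ) = n * G.degree u := by
      rw [sum_congr rfl fun w _ => by rw [hreg w u], sum_const, card_univ, nsmul_eq_mul]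
    have hu' : (2 * G.degree u : ℤ) ≤ n := by omega
    nlinarith [sq_nonneg ((n : ℤ) - 5)]
  · push Not at hcase
    have hni : n = 2 * i ∧ (i = 4 ∨ i = 5) := by omega
    obtain ⟨hni, hi45⟩ := hni
    have hle' : i ≤ #{w | G.degree w ≤ n - i} := by omega
    obtain ⟨S, hS, hSi⟩ := exists_subset_card_eq hle'
    have hbound := hconn.spectralRadius_ge_of_half hρ (S := S) (by omega) fun w hw => by
      have := (mem_filter.1 (hS hw)).2
      omega
    rw [hSi] at hbound
    have hni' : (n : ℝ) = 2 * i := by exact_mod_cast hni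
    rw [hni'] at hρn
    rcases hi45 with rfl | rfl <;> norm_num at hbound hρn <;> linarith
end
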